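/- arXiv:2110.06749 — 2 statements merged into one kernel-verified Lean document; each statement's English description precedes it below -/
import Mathlib

section
/- There is an isomorphism of R-modules Hom_R(H^c_I(ω_R), H^c_I(ω_R)) ≅ Ext^c_R(H^c_I(ω_R), ω_R). -/
open CategoryTheory Opposite

set_option synthInstance.maxHeartbeats 1000000
set_option maxHeartbeats 1000000

noncomputable section

/-- The grade of an ideal: the maximal length of a regular sequence contained in it. -/
def idealGrade {A : Type} [CommRing A] (J : Ideal A) : ℕ∞ :=
  sSup {c : ℕ∞ | ∃ rs : List A, (∀ r ∈ rs, r ∈ J) ∧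
    RingTheory.Sequence.IsRegular A rs ∧ (rs.length : ℕ∞) = c}

/-- A canonical module of a `d`-dimensional local ring `A`: a finitely generated module `ω`
with `Ext_A^i(𝕜, ω) = 0` for `i ≠ d` and `Ext_A^d(𝕜, ω)` a one-dimensional `𝕜`-vector space
(equivalently, isomorphic to `𝕜` as an `A`-module), where `𝕜` is the residue field. -/
def IsCanonicalModule (A : Type) [CommRing A] [IsLocalRing A] (d : ℕ)
    (ω : ModuleCat A) : Prop :=
  Module.Finite A ω ∧
  (∀ i : ℕ, i ≠ d → Subsingleton
    (((Ext A (ModuleCat A) i).obj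
      (op (ModuleCat.of A (IsLocalRing.ResidueField A)))).obj ω)) ∧
  Nonempty ((((Ext A (ModuleCat A) d).obj
      (op (ModuleCat.of A (IsLocalRing.ResidueField A)))).obj ω)
    ≃ₗ[A] IsLocalRing.ResidueField A)

/- `(R, 𝔪, 𝕜)` is a `d`-dimensional complete local Cohen-Macaulay ring (Cohen-Macaulayness
being expressed as `grade 𝔪 = d = dim R`) with canonical module `ω`, `I ⊆ R` is an ideal
with `c = grade I`, and `H^c_I(ω) ≠ 0`. -/
variable (R : Type) [CommRing R] [IsLocalRing R] [IsNoetherianRing R]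
  [IsAdicComplete (IsLocalRing.maximalIdeal R) R]

open IsLocalRing in
/-- Ischebeck's theorem: over a local ring, if `Ext^i(𝕜, M) = 0` for `i < d`, then
`Ext^i(N, M) = 0` for every finitely generated `N` with `i + dim N < d`. -/
theorem subsingleton_ext_of_supportDim_lt {R : Type} [CommRing R] [IsLocalRing R]
    [IsNoetherianRing R] (M : ModuleCat.{0} R) [Module.Finite R M] (d : ℕ)
    (hM : ∀ i < d, Subsingleton (Abelian.Ext (ModuleCat.of R (ResidueField R)) M i)) (n : ℕ) :
    ∀ (N : Type) [AddCommGroup N] [Module R N] [Module.Finite R N],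
      Module.supportDim R N < n → ∀ i, i + n ≤ d →
      Subsingleton (Abelian.Ext (ModuleCat.of R N) M i) := by
  induction n with
  | zero =>
    intro N _ _ _ hN i hi
    have : Subsingleton N := by
      rw [← Module.supportDim_eq_bot_iff_subsingleton (R := R)]
      by_contra h
      obtain ⟨k, hk⟩ := WithBot.ne_bot_iff_exists.1 h
      rw [← hk] at hN
      exact absurd (WithBot.coe_lt_coe.1 hN) (by simp)
    have hz : Limits.IsZero (ModuleCat.of R N) := ModuleCat.isZero_of_subsingleton _
    refine ⟨fun a b ↦ ?_⟩
    rw [← Abelian.Ext.mk₀_id_comp a, ← Abelian.Ext.mk₀_id_comp b, hz.eq_of_src (𝟙 _) 0]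
    simp
  | succ n ih =>
    intro N _ _ hfin
    refine IsNoetherianRing.induction_on_isQuotientEquivQuotientPrime R hfin
      (motive := fun N _ _ _ ↦ Module.supportDim R N < (n + 1 : ℕ) → ∀ i, i + (n + 1) ≤ d →
        Subsingleton (Abelian.Ext (ModuleCat.of R N) M i)) ?_ ?_ ?_
    · intro N _ _ _ hN _ i hi
      have hz : Limits.IsZero (ModuleCat.of R N) := ModuleCat.isZero_of_subsingleton _
      refine ⟨fun a b ↦ ?_⟩
      rw [← Abelian.Ext.mk₀_id_comp a, ← Abelian.Ext.mk₀_id_comp b, hz.eq_of_src (𝟙 _) 0]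
      simp
    · intro N _ _ _ p e hN i hi
      by_cases hp : p.1 = maximalIdeal R
      · rw [hp] at e
        have := hM i (by omega)
        refine ⟨fun a b ↦ ?_⟩
        have e' : ModuleCat.of R N ≅ ModuleCat.of R (ResidueField R) := e.toModuleIso
        rw [← Abelian.Ext.mk₀_id_comp a, ← Abelian.Ext.mk₀_id_comp b, ← e'.hom_inv_id,
          ← Abelian.Ext.mk₀_comp_mk₀_assoc, ← Abelian.Ext.mk₀_comp_mk₀_assoc]
        congr 1
        exact Subsingleton.elim _ _
      · obtain ⟨x, hxm, hxp⟩ : ∃ x ∈ maximalIdeal R, x ∉ p.1 := by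
          by_contra! h
          exact hp (le_antisymm (le_maximalIdeal p.2.ne_top) h)
        have reg : IsSMulRegular N x := by
          rw [e.isSMulRegular_congr]
          intro a b
          obtain ⟨a, rfl⟩ := Ideal.Quotient.mk_surjective a
          obtain ⟨b, rfl⟩ := Ideal.Quotient.mk_surjective b
          intro hab
          change Ideal.Quotient.mk p.1 (x * a) = Ideal.Quotient.mk p.1 (x * b) at hab
          rw [Ideal.Quotient.eq, ← mul_sub] at hab
          exact Ideal.Quotient.eq.2 ((p.2.mem_or_mem hab).resolve_left hxp)
        have hdim := Module.supportDim_quotSMulTop_succ_eq_supportDim reg hxm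
        have hlt : Module.supportDim R (QuotSMulTop x N) < n := by
          rw [← hdim] at hN
          generalize Module.supportDim R (QuotSMulTop x N) = s at hN
          push_cast at hN
          by_contra! h
          exact absurd hN (not_lt.2 (by gcongr))
        have hz := ih (QuotSMulTop x N) hlt (i + 1) (by omega)
        have hreg : IsSMulRegular (ModuleCat.of R N) x := reg
        have hS := hreg.smulShortComplex_shortExact
        have hsurj : ∀ a : Abelian.Ext (ModuleCat.of R N) M i, ∃ b, x • b = a := by
          intro a
          obtain ⟨b, hb⟩ := Abelian.Ext.contravariant_sequence_exact₁ hS M a (add_comm 1 i)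
            (hz.elim _ _)
          have hb' : (Abelian.Ext.mk₀ (x • 𝟙 (ModuleCat.of R N))).comp
              (show Abelian.Ext (ModuleCat.of R N) M i from b) (zero_add i) = a := by
            rw [← hb, ← ModuleCat.smulShortComplex_f_eq_smul_id]
            rfl
          refine ⟨b, ?_⟩
          rwa [Abelian.Ext.mk₀_smul, Abelian.Ext.smul_comp, Abelian.Ext.mk₀_id_comp] at hb'
        rw [← Submodule.subsingleton_iff R, ← subsingleton_iff_bot_eq_top, eq_comm]
        refine Submodule.eq_bot_of_le_smul_of_le_jacobson_bot (maximalIdeal R) ⊤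
          Module.Finite.fg_top ?_ (maximalIdeal_le_jacobson _)
        intro a _
        obtain ⟨b, rfl⟩ := hsurj a
        exact Submodule.smul_mem_smul hxm trivial
    · intro N₁ _ _ _ N₂ _ _ _ N₃ _ _ _ f g hf hg hfg h₁ h₃ hN i hi
      have := h₁ ((Module.supportDim_le_of_injective f hf).trans_lt hN) i hi
      have := h₃ ((Module.supportDim_le_of_surjective g hg).trans_lt hN) i hi
      let S : ShortComplex (ModuleCat R) := ShortComplex.mk (ModuleCat.ofHom f)
        (ModuleCat.ofHom g) (by ext x; exact hfg.apply_apply_eq_zero x)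
      have hS : S.ShortExact :=
        { exact := (ShortComplex.ShortExact.moduleCat_exact_iff_function_exact S).2 hfg
          mono_f := (ModuleCat.mono_iff_injective _).2 hf
          epi_g := (ModuleCat.epi_iff_surjective _).2 hg }
      refine subsingleton_of_forall_eq 0 fun a ↦ ?_
      obtain ⟨b, hb⟩ := Abelian.Ext.contravariant_sequence_exact₂ hS M a
        (Subsingleton.elim (α := Abelian.Ext (ModuleCat.of R N₁) M i) _ _)
      rw [← hb, Subsingleton.elim (α := Abelian.Ext (ModuleCat.of R N₃) M i) b 0]
      simp

/-- Every element of `N` is annihilated by some power of `I`. -/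
def IsPowTorsion {R : Type} [CommRing R] (I : Ideal R) (N : Type) [AddCommGroup N]
    [Module R N] : Prop :=
  ∀ n : N, ∃ t : ℕ, ∀ a ∈ I ^ t, a • n = 0

theorem injective_restrictScalars_of_flat {R S : Type} [CommRing R] [CommRing S] (f : R →+* S)
    (hf : f.Flat) (E : ModuleCat.{0} S) [Injective E] :
    Injective ((ModuleCat.restrictScalars f).obj E) := by
  have : (ModuleCat.extendScalars.{0, 0, 0} f).PreservesMonomorphisms := by
    refine ⟨fun {X Y} g hg ↦ ?_⟩
    rw [ModuleCat.mono_iff_injective] at hg ⊢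
    algebraize [f]
    exact Module.Flat.lTensor_preserves_injective_linearMap (M := S) g.hom hg
  exact (ModuleCat.extendRestrictScalarsAdj f).map_injective E inferInstance

/-- A module without `I`-power torsion embeds in an injective module without `I`-power torsion. -/
theorem exists_mono_injective_torsionFree {R : Type} [CommRing R] [IsNoetherianRing R]
    (I : Ideal R) (M : ModuleCat.{0} R)
    (hM : ∀ (m : M) (t : ℕ), (∀ a ∈ I ^ t, a • m = 0) → m = 0) :
    ∃ (E : ModuleCat.{0} R) (f : M ⟶ E), Injective E ∧ Mono f ∧
      ∀ (N : ModuleCat.{0} R), IsPowTorsion I N → ∀ g : N ⟶ E, g = 0 := by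
  let L (x : I) : ModuleCat (Localization.Away x.1) :=
    ModuleCat.of _ (LocalizedModule (Submonoid.powers x.1) M)
  let E (x : I) : ModuleCat.{0} R :=
    (ModuleCat.restrictScalars (algebraMap R (Localization.Away x.1))).obj (Injective.under (L x))
  have hE (x : I) : Injective (E x) :=
    have : Module.Flat R (Localization.Away x.1) :=
      IsLocalization.flat _ (Submonoid.powers x.1)
    injective_restrictScalars_of_flat _ ((RingHom.flat_algebraMap_iff).2 this) _
  let φ (x : I) : M ⟶ E x := ModuleCat.ofHom (Y := E x)
    { toFun m := (Injective.ι (L x)).hom (LocalizedModule.mk m 1)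
      map_add' a b :=
        (congrArg (Injective.ι (L x)).hom
          ((LocalizedModule.mkLinearMap (Submonoid.powers x.1) M).map_add a b)).trans
          ((Injective.ι (L x)).hom.map_add _ _)
      map_smul' r a :=
        (congrArg (Injective.ι (L x)).hom
          (((LocalizedModule.mkLinearMap (Submonoid.powers x.1) M).map_smul r a).trans
            (algebraMap_smul (Localization.Away x.1) r
              (LocalizedModule.mk a 1 : LocalizedModule (Submonoid.powers x.1) M)).symm)).trans
          ((Injective.ι (L x)).hom.map_smul (algebraMap R (Localization.Away x.1) r) _) }
  refine ⟨∏ᶜ E, Limits.Pi.lift φ, inferInstance, ?_, ?_⟩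
  · rw [ModuleCat.mono_iff_injective, injective_iff_map_eq_zero]
    intro m hm
    have hx (x : I) : ∃ k : ℕ, x.1 ^ k • m = 0 := by
      have h1 : φ x m = 0 := by
        rw [← Limits.Pi.lift_π φ x, ModuleCat.comp_apply, hm, map_zero]
      have h2 : (LocalizedModule.mk m 1 : LocalizedModule (Submonoid.powers x.1) M) = 0 :=
        (ModuleCat.mono_iff_injective (Injective.ι (L x))).1 inferInstance (h1.trans (map_zero _).symm)
      rw [← LocalizedModule.zero_mk 1, LocalizedModule.mk_eq] at h2
      obtain ⟨⟨_, k, rfl⟩, hk⟩ := h2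
      refine ⟨k, ?_⟩
      rwa [one_smul, smul_zero, smul_zero] at hk
    obtain ⟨t, ht⟩ := Ideal.exists_pow_le_of_le_radical_of_fg
      (I := I) (J := LinearMap.ker (LinearMap.toSpanSingleton R M m)) (fun x hxI ↦ by
        obtain ⟨k, hk⟩ := hx ⟨x, hxI⟩
        exact ⟨k, hk⟩) ((isNoetherianRing_iff_ideal_fg R).1 inferInstance I)
    exact hM m t fun a ha ↦ ht ha
  · intro N hN g
    refine Limits.Pi.hom_ext _ _ fun x ↦ ?_
    ext n
    obtain ⟨t, ht⟩ := hN n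
    have h := ht (x.1 ^ t) (Ideal.pow_mem_pow x.2 t)
    have h2 : x.1 ^ t • ((g ≫ Limits.Pi.π E x) n) = 0 := by rw [← map_smul, h, map_zero]
    have h3 : (algebraMap R (Localization.Away x.1) (x.1 ^ t)) •
      (id ((g ≫ Limits.Pi.π E x) n) : ↑(Injective.under (L x))) = 0 := h2
    have hu : IsUnit (algebraMap R (Localization.Away x.1) (x.1 ^ t)) :=
      IsLocalization.map_units (M := Submonoid.powers x.1) _ ⟨_, t, rfl⟩
    rw [Limits.zero_comp]
    exact hu.smul_eq_zero.1 h3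

theorem subsingleton_ext_of_torsionFree_injective {R : Type} [CommRing R] {I : Ideal R} {E : ModuleCat.{0} R} [Injective E]
    (hE : ∀ (N : ModuleCat.{0} R), IsPowTorsion I N → ∀ g : N ⟶ E, g = 0)
    (N : ModuleCat.{0} R) (hN : IsPowTorsion I N) (i : ℕ) : Subsingleton (Abelian.Ext N E i) := by
  refine subsingleton_of_forall_eq 0 fun a ↦ ?_
  cases i with
  | zero =>
    obtain ⟨g, rfl⟩ := Abelian.Ext.addEquiv₀.symm.surjective a
    rw [hE N hN g, map_zero]
  | succ i => exact Abelian.Ext.eq_zero_of_injective a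

theorem isPowTorsion_quotient {R : Type} [CommRing R] (I : Ideal R) (t : ℕ) :
    IsPowTorsion I (R ⧸ I ^ t) := by
  intro n
  obtain ⟨n, rfl⟩ := Ideal.Quotient.mk_surjective n
  refine ⟨t, fun a ha ↦ ?_⟩
  rw [Algebra.smul_def, Ideal.Quotient.algebraMap_eq, ← map_mul, Ideal.Quotient.eq_zero_iff_mem]
  exact Ideal.mul_mem_right _ _ ha

/-- If `Ext^i(R ⧸ I ^ t, M) = 0` for all `i < c` and all `t`, then `Ext^c(-, M)` is representable
on `I`-power torsion modules. -/
theorem exists_natural_ext_linearEquiv_hom {R : Type} [CommRing R] [IsNoetherianRing R]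
    (I : Ideal R) (c : ℕ) : ∀ (M : ModuleCat.{0} R),
    (∀ i < c, ∀ t : ℕ, Subsingleton (Abelian.Ext (ModuleCat.of R (R ⧸ I ^ t)) M i)) →
    ∃ (W : ModuleCat.{0} R)
      (φ : ∀ N : ModuleCat.{0} R, IsPowTorsion I N → (Abelian.Ext N M c ≃ₗ[R] (N ⟶ W))),
      ∀ (N N' : ModuleCat.{0} R) (hN : IsPowTorsion I N) (hN' : IsPowTorsion I N')
        (g : N ⟶ N') (a : Abelian.Ext N' M c),
        φ N hN ((Abelian.Ext.mk₀ g).comp a (zero_add c)) = g ≫ φ N' hN' a := by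
  induction c with
  | zero =>
    intro M _
    refine ⟨M, fun N _ ↦ Abelian.Ext.linearEquiv₀, fun N N' _ _ g a ↦ ?_⟩
    obtain ⟨f, rfl⟩ := (Abelian.Ext.linearEquiv₀ (R := R)).symm.surjective a
    apply (Abelian.Ext.linearEquiv₀ (R := R)).symm.injective
    rw [LinearEquiv.symm_apply_apply, LinearEquiv.apply_symm_apply]
    exact Abelian.Ext.mk₀_comp_mk₀ g f
  | succ c ih =>
    intro M hM
    obtain ⟨E, f, hE, hf, htf⟩ := exists_mono_injective_torsionFree I M fun m t hm ↦ by
      have := hM 0 (by omega) t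
      have : Subsingleton (ModuleCat.of R (R ⧸ I ^ t) ⟶ M) :=
        Abelian.Ext.addEquiv₀.symm.subsingleton
      let g : (R ⧸ I ^ t) →ₗ[R] M :=
        Submodule.liftQ (I ^ t) (LinearMap.toSpanSingleton R M m) fun a ha ↦ hm a ha
      have hg : ModuleCat.ofHom g = 0 := Subsingleton.elim _ _
      have : g (Submodule.Quotient.mk 1) = 0 := congr($hg (Submodule.Quotient.mk 1))
      exact (one_smul R m).symm.trans this
    let S : ShortComplex (ModuleCat.{0} R) :=
      ShortComplex.mk f (Limits.cokernel.π f) (Limits.cokernel.condition f)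
    have hS : S.ShortExact :=
      { exact := ShortComplex.exact_of_g_is_cokernel _ (Limits.cokernelIsCokernel f) }
    have hz (N : ModuleCat.{0} R) (hN : IsPowTorsion I N) (i : ℕ) :
        Subsingleton (Abelian.Ext N S.X₂ i) := subsingleton_ext_of_torsionFree_injective htf N hN i
    have hbij (N : ModuleCat.{0} R) (hN : IsPowTorsion I N) (i : ℕ) :
        Function.Bijective (hS.extClass.postcompOfLinear R N (rfl : i + 1 = i + 1)) := by
      constructor
      · rw [injective_iff_map_eq_zero]
        intro a ha
        obtain ⟨b, rfl⟩ := Abelian.Ext.covariant_sequence_exact₃ N hS a rfl ha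
        rw [(hz N hN i).elim b 0, Abelian.Ext.zero_comp]
      · intro a
        exact Abelian.Ext.covariant_sequence_exact₁ N hS a ((hz N hN _).elim _ _) rfl
    obtain ⟨W, φ, hφ⟩ := ih S.X₃ fun i hi t ↦
      have := hM (i + 1) (by omega) t
      (hbij _ (isPowTorsion_quotient I t) i).1.subsingleton
    refine ⟨W, fun N hN ↦ (LinearEquiv.ofBijective _ (hbij N hN c)).symm.trans (φ N hN), ?_⟩
    intro N N' hN hN' g a
    obtain ⟨a, rfl⟩ := (LinearEquiv.ofBijective _ (hbij N' hN' c)).surjective a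
    have : (Abelian.Ext.mk₀ g).comp (LinearEquiv.ofBijective _ (hbij N' hN' c) a)
        (zero_add (c + 1)) = LinearEquiv.ofBijective _ (hbij N hN c)
          ((Abelian.Ext.mk₀ g).comp a (zero_add c)) :=
      (Abelian.Ext.comp_assoc _ _ _ (zero_add c) rfl (by omega)).symm
    rw [this, LinearEquiv.trans_apply, LinearEquiv.trans_apply, LinearEquiv.symm_apply_apply,
      LinearEquiv.symm_apply_apply, hφ N N' hN hN']

theorem extMk_eq_zero_iff_exists {R : Type} [CommRing R] {X Y : ModuleCat.{0} R}
    (P : ProjectiveResolution X) (n : ℕ) (f : P.complex.X n ⟶ Y)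
    (hf : P.complex.d (n + 1) n ≫ f = 0) :
    P.extMk f (n + 1) rfl hf = 0 ↔
      ∃ y : P.complex.X ((ComplexShape.up ℕ).prev n) ⟶ Y,
        P.complex.d n ((ComplexShape.up ℕ).prev n) ≫ y = f := by
  cases n with
  | zero =>
    have hd : P.complex.d 0 ((ComplexShape.up ℕ).prev 0) = 0 := by simp
    simp only [hd, Limits.zero_comp]
    have hI : Limits.IsZero (P.cochainComplex.X 1) := P.cochainComplex.isZero_of_isStrictlyLE 0 1
    simp only [← P.extEquivCohomologyClass.apply_eq_iff_eq,
      ProjectiveResolution.extEquivCohomologyClass_extMk,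
      ProjectiveResolution.extEquivCohomologyClass_zero,
      CochainComplex.HomComplex.CohomologyClass.mk_eq_zero_iff]
    rw [CochainComplex.HomComplex.Cocycle.toSingleMk_mem_coboundaries_iff _ _ _ _ _ 1 (by lia),
      ← cancel_epi (P.cochainComplexXIso (-(0 : ℕ)) 0 rfl).hom]
    constructor
    · rintro ⟨g, hg⟩
      exact ⟨0, by rw [← hg, hI.eq_of_src g 0]; simp⟩
    · rintro ⟨-, h⟩
      exact ⟨0, by rw [← h]; simp⟩
  | succ p =>
    rw [P.extMk_eq_zero_iff f _ rfl hf p rfl, show (ComplexShape.up ℕ).prev (p + 1) = p by simp]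

/-- The inclusion of the `n`-cocycles of the complex of morphisms from `P` to `Y`. -/
noncomputable def cyclesToHom {R : Type} [CommRing R] {X : ModuleCat.{0} R}
    (P : ProjectiveResolution X) (Y : ModuleCat.{0} R) (n : ℕ) :
    (P.complex.linearYonedaObj R Y).cycles n →ₗ[R] (P.complex.X n ⟶ Y) :=
  ((P.complex.linearYonedaObj R Y).iCycles n).hom

theorem d_comp_cyclesToHom {R : Type} [CommRing R] {X : ModuleCat.{0} R}
    (P : ProjectiveResolution X) (Y : ModuleCat.{0} R) (n : ℕ)
    (x : (P.complex.linearYonedaObj R Y).cycles n) :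
    P.complex.d (n + 1) n ≫ cyclesToHom P Y n x = 0 :=
  congr($((P.complex.linearYonedaObj R Y).iCycles_d n (n + 1)) x)

/-- The linear map sending an `n`-cocycle of a projective resolution to its class in `Ext`. -/
noncomputable def cyclesToExt {R : Type} [CommRing R] {X : ModuleCat.{0} R}
    (P : ProjectiveResolution X) (Y : ModuleCat.{0} R) (n : ℕ) :
    (P.complex.linearYonedaObj R Y).cycles n →ₗ[R] Abelian.Ext X Y n where
  toFun x := P.extMk (cyclesToHom P Y n x) (n + 1) rfl (d_comp_cyclesToHom P Y n x)
  map_add' x y := by simp only [P.add_extMk, map_add]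
  map_smul' r x := by
    simp only [RingHom.id_apply, Abelian.Ext.smul_eq_comp_mk₀, P.extMk_comp_mk₀, map_smul,
      Linear.comp_smul, Category.comp_id]

theorem cyclesToExt_surjective {R : Type} [CommRing R] {X : ModuleCat.{0} R}
    (P : ProjectiveResolution X) (Y : ModuleCat.{0} R) (n : ℕ) :
    Function.Surjective (cyclesToExt P Y n) := by
  intro a
  obtain ⟨f, hf, rfl⟩ := P.extMk_surjective a (n + 1) rfl
  let K := P.complex.linearYonedaObj R Y
  let k : ModuleCat.of R R ⟶ K.X n :=
    ModuleCat.ofHom (Y := K.X n) (LinearMap.toSpanSingleton R (P.complex.X n ⟶ Y) f)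
  have hk : k ≫ K.d n (n + 1) = 0 := by
    ext
    change P.complex.d (n + 1) n ≫ ((1 : R) • f) = 0
    rw [one_smul, hf]
  refine ⟨K.liftCycles k (n + 1) (by simp) hk (1 : R), ?_⟩
  have h : cyclesToHom P Y n (K.liftCycles k (n + 1) (by simp) hk (1 : R)) = f :=
    (congr($(K.liftCycles_i k (n + 1) (by simp) hk) (1 : R))).trans (one_smul R f)
  simp only [cyclesToExt, LinearMap.coe_mk, AddHom.coe_mk, h]

theorem ker_homologyπ_eq_ker_cyclesToExt {R : Type} [CommRing R] {X : ModuleCat.{0} R}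
    (P : ProjectiveResolution X) (Y : ModuleCat.{0} R) (n : ℕ) :
    LinearMap.ker ((P.complex.linearYonedaObj R Y).homologyπ n).hom =
      LinearMap.ker (cyclesToExt P Y n) := by
  ext x
  let K := P.complex.linearYonedaObj R Y
  have hex := ShortComplex.exact_of_g_is_cokernel
    (ShortComplex.mk _ _ (K.toCycles_comp_homologyπ ((ComplexShape.up ℕ).prev n) n))
    (K.homologyIsCokernel _ n rfl)
  have hi : Function.Injective (K.iCycles n) := (ModuleCat.mono_iff_injective _).1 inferInstance
  have hx : K.homologyπ n x = 0 ↔ ∃ y, K.d ((ComplexShape.up ℕ).prev n) n y = K.iCycles n x := by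
    constructor
    · intro h
      obtain ⟨y, rfl⟩ := (ShortComplex.moduleCat_exact_iff _).1 hex x h
      exact ⟨y, congr($((K.toCycles_i _ n).symm) y)⟩
    · rintro ⟨y, hy⟩
      have : K.toCycles ((ComplexShape.up ℕ).prev n) n y = x :=
        hi (congr($(K.toCycles_i _ n) y).trans hy)
      rw [← this]
      exact congr($(K.toCycles_comp_homologyπ ((ComplexShape.up ℕ).prev n) n) y)
  exact hx.trans (extMk_eq_zero_iff_exists P n _
    (d_comp_cyclesToHom P Y n x)).symm

/-- Yoneda's `Ext` is the cohomology of the dual of a projective resolution. -/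
noncomputable def homologyLinearEquivExt {R : Type} [CommRing R] {X : ModuleCat.{0} R}
    (P : ProjectiveResolution X) (Y : ModuleCat.{0} R) (n : ℕ) :
    (P.complex.linearYonedaObj R Y).homology n ≃ₗ[R] Abelian.Ext X Y n :=
  (((P.complex.linearYonedaObj R Y).homologyπ n).hom.quotKerEquivOfSurjective
    ((ModuleCat.epi_iff_surjective _).1 inferInstance)).symm.trans
  ((Submodule.quotEquivOfEq _ _ (ker_homologyπ_eq_ker_cyclesToExt P Y n)).trans
    ((cyclesToExt P Y n).quotKerEquivOfSurjective (cyclesToExt_surjective P Y n)))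

theorem homologyLinearEquivExt_homologyπ {R : Type} [CommRing R] {X : ModuleCat.{0} R}
    (P : ProjectiveResolution X) (Y : ModuleCat.{0} R) (n : ℕ)
    (x : (P.complex.linearYonedaObj R Y).cycles n) :
    homologyLinearEquivExt P Y n ((P.complex.linearYonedaObj R Y).homologyπ n x) =
      cyclesToExt P Y n x := by
  have : (((P.complex.linearYonedaObj R Y).homologyπ n).hom.quotKerEquivOfSurjective
    ((ModuleCat.epi_iff_surjective _).1 inferInstance)).symm
      ((P.complex.linearYonedaObj R Y).homologyπ n x) = Submodule.Quotient.mk x := by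
    rw [LinearEquiv.symm_apply_eq]
    rfl
  rw [homologyLinearEquivExt, LinearEquiv.trans_apply, this]
  rfl

/-- Precomposition with a map of chain complexes, on complexes of morphisms to `Y`. -/
noncomputable def linearYonedaObjMap {R : Type} [CommRing R]
    {K L : ChainComplex (ModuleCat.{0} R) ℕ} (φ : K ⟶ L) (Y : ModuleCat.{0} R) : L.linearYonedaObj R Y ⟶ K.linearYonedaObj R Y :=
  (HomologicalComplex.unopFunctor _ _).map
    ((((linearYoneda R (ModuleCat R)).obj Y).rightOp.mapHomologicalComplex _).map φ).op

/-- The two definitions of `Ext` agree. -/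
noncomputable def extLinearEquivExt {R : Type} [CommRing R] (X Y : ModuleCat.{0} R) (n : ℕ) :
    ((Ext R (ModuleCat.{0} R) n).obj (op X)).obj Y ≃ₗ[R] Abelian.Ext X Y n :=
  ((projectiveResolution X).isoExt n Y).toLinearEquiv.trans
    (homologyLinearEquivExt (projectiveResolution X) Y n)

theorem homologyLinearEquivExt_naturality {R : Type} [CommRing R] {X X' Y : ModuleCat.{0} R}
    {P : ProjectiveResolution X} {P' : ProjectiveResolution X'} {g : X' ⟶ X}
    (φ : ProjectiveResolution.Hom P' P g) (n : ℕ)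
    (a : (P.complex.linearYonedaObj R Y).homology n) :
    homologyLinearEquivExt P' Y n
      (HomologicalComplex.homologyMap (linearYonedaObjMap φ.hom Y) n a) =
      (Abelian.Ext.mk₀ g).comp (homologyLinearEquivExt P Y n a) (zero_add n) := by
  obtain ⟨x, rfl⟩ := (ModuleCat.epi_iff_surjective
    ((P.complex.linearYonedaObj R Y).homologyπ n)).1 inferInstance a
  have h := congr($(HomologicalComplex.homologyπ_naturality (linearYonedaObjMap φ.hom Y) n) x)
  have hc : cyclesToHom P' Y n (HomologicalComplex.cyclesMap (linearYonedaObjMap φ.hom Y) n x) =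
      φ.hom.f n ≫ cyclesToHom P Y n x :=
    congr($(HomologicalComplex.cyclesMap_i (linearYonedaObjMap φ.hom Y) n) x)
  rw [ModuleCat.comp_apply, ModuleCat.comp_apply] at h
  rw [h, homologyLinearEquivExt_homologyπ, homologyLinearEquivExt_homologyπ]
  simp only [cyclesToExt, LinearMap.coe_mk, AddHom.coe_mk, hc]
  rw [ProjectiveResolution.mk₀_comp_extMk _ _ _ _ φ]

theorem homologyUnop_inv_naturality {R : Type} [CommRing R] {ι : Type} {c : ComplexShape ι}
    {K L : HomologicalComplex (ModuleCat.{0} R)ᵒᵖ c} (φ : K ⟶ L) (i : ι) :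
    (HomologicalComplex.homologyMap φ i).unop ≫ (K.homologyUnop i).inv =
      (L.homologyUnop i).inv ≫
        HomologicalComplex.homologyMap ((HomologicalComplex.unopFunctor _ _).map φ.op) i := by
  let ψ : L.unop ⟶ K.unop := (HomologicalComplex.unopFunctor _ _).map φ.op
  have h : (L.homologyUnop i).hom ≫ (HomologicalComplex.homologyMap φ i).unop =
      HomologicalComplex.homologyMap ψ i ≫ (K.homologyUnop i).hom :=
    congrArg Quiver.Hom.unop (HomologicalComplex.homologyOp_hom_naturality ψ i)
  have h' : (HomologicalComplex.homologyMap φ i).unop ≫ (K.homologyUnop i).inv =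
      (L.homologyUnop i).inv ≫ HomologicalComplex.homologyMap ψ i := by
    rw [Iso.comp_inv_eq, Category.assoc, Iso.eq_inv_comp, h]
  exact h'

theorem isoExt_hom_naturality {R : Type} [CommRing R] {X X' : ModuleCat.{0} R}
    {P : ProjectiveResolution X} {P' : ProjectiveResolution X'} {g : X' ⟶ X}
    (φ : ProjectiveResolution.Hom P' P g) (Y : ModuleCat.{0} R) (n : ℕ) :
    ((Ext R (ModuleCat.{0} R) n).map g.op).app Y ≫ (P'.isoExt n Y).hom =
      (P.isoExt n Y).hom ≫ HomologicalComplex.homologyMap (linearYonedaObjMap φ.hom Y) n := by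
  have h := congrArg Quiver.Hom.unop (ProjectiveResolution.isoLeftDerivedObj_inv_naturality g P' P
    φ.hom φ.hom_f_zero_comp_π_f_zero ((linearYoneda R (ModuleCat.{0} R)).obj Y).rightOp n)
  have h₂ := homologyUnop_inv_naturality
    ((((linearYoneda R (ModuleCat R)).obj Y).rightOp.mapHomologicalComplex _).map φ.hom) n
  have h₃ := congr($h ≫ ((HomologicalComplex.homologyUnop _ _).inv))
  exact (Category.assoc _ _ _).symm.trans
    ((h₃.trans (Category.assoc _ _ _)).trans ((congrArg (_ ≫ ·) h₂).trans
      (Category.assoc _ _ _).symm))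

theorem extLinearEquivExt_naturality {R : Type} [CommRing R] {X X' : ModuleCat.{0} R}
    (g : X' ⟶ X) (Y : ModuleCat.{0} R) (n : ℕ)
    (a : ((Ext R (ModuleCat.{0} R) n).obj (op X)).obj Y) :
    extLinearEquivExt X' Y n (((Ext R (ModuleCat.{0} R) n).map g.op).app Y a) =
      (Abelian.Ext.mk₀ g).comp (extLinearEquivExt X Y n a) (zero_add n) := by
  let φ : ProjectiveResolution.Hom (projectiveResolution X') (projectiveResolution X) g :=
    ⟨ProjectiveResolution.lift g _ _, ProjectiveResolution.lift_commutes_zero g _ _⟩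
  exact (congrArg (homologyLinearEquivExt _ Y n) congr($(isoExt_hom_naturality φ Y n) a)).trans
    (homologyLinearEquivExt_naturality φ n _)

theorem exists_isRegular_of_idealGrade_eq {R : Type} [CommRing R] [Nontrivial R] {I : Ideal R}
    {c : ℕ} (hc : idealGrade I = (c : ℕ∞)) :
    ∃ rs : List R, (∀ r ∈ rs, r ∈ I) ∧ RingTheory.Sequence.IsRegular R rs ∧ rs.length = c := by
  let s := {c : ℕ∞ | ∃ rs : List R, (∀ r ∈ rs, r ∈ I) ∧
    RingTheory.Sequence.IsRegular R rs ∧ (rs.length : ℕ∞) = c}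
  have : Nonempty s := ⟨⟨0, [], by simp, RingTheory.Sequence.IsRegular.nil R R, rfl⟩⟩
  have hs : sSup s = c := hc
  obtain ⟨rs, h₁, h₂, h₃⟩ := ENat.sSup_mem_of_nonempty_of_lt_top (s := s)
    (hs ▸ ENat.natCast_lt_top c)
  exact ⟨rs, h₁, h₂, by rw [hs] at h₃; exact_mod_cast h₃⟩

theorem supportDim_quotient_pow_le {R : Type} [CommRing R] {I J : Ideal R} (h : J ≤ I) (t : ℕ) :
    Module.supportDim R (R ⧸ I ^ t) ≤ Module.supportDim R (R ⧸ J • (⊤ : Submodule R R)) := by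
  have hsub : Module.support R (R ⧸ I ^ t) ⊆ Module.support R (R ⧸ J • (⊤ : Submodule R R)) := by
    intro p hp
    rw [smul_eq_mul, Ideal.mul_top]
    rw [Module.support_eq_zeroLocus, Ideal.annihilator_quotient,
      PrimeSpectrum.mem_zeroLocus] at hp ⊢
    exact h.trans (p.2.le_of_pow_le hp)
  exact Order.krullDim_le_of_strictMono (Set.inclusion hsub) fun _ _ h ↦ h

open IsLocalRing in
theorem subsingleton_ext_quotient_pow {R : Type} [CommRing R] [IsLocalRing R]
    [IsNoetherianRing R] (M : ModuleCat.{0} R) [Module.Finite R M] (d : ℕ)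
    (hd : ringKrullDim R = (d : WithBot ℕ∞))
    (hM : ∀ i < d, Subsingleton (Abelian.Ext (ModuleCat.of R (ResidueField R)) M i))
    (I : Ideal R) (c : ℕ) (hc : idealGrade I = (c : ℕ∞)) (i : ℕ) (hi : i < c) (t : ℕ) :
    Subsingleton (Abelian.Ext (ModuleCat.of R (R ⧸ I ^ t)) M i) := by
  obtain ⟨rs, hrs, hreg, rfl⟩ := exists_isRegular_of_idealGrade_eq hc
  have hdim := Module.supportDim_add_length_eq_supportDim_of_isRegular rs hreg
  rw [Module.supportDim_self_eq_ringKrullDim, hd] at hdim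
  have hle := supportDim_quotient_pow_le (I := I) (J := Ideal.ofList rs) (Ideal.span_le.2 hrs) t
  obtain ⟨k, hk, hkd⟩ : ∃ k : ℕ, Module.supportDim R (R ⧸ Ideal.ofList rs • (⊤ : Submodule R R)) =
      (k : WithBot ℕ∞) ∧ k + rs.length = d := by
    generalize Module.supportDim R (R ⧸ Ideal.ofList rs • (⊤ : Submodule R R)) = s at hdim
    induction s with
    | bot => simp at hdim
    | coe s =>
      induction s with
      | top => exact absurd (WithBot.coe_injective hdim : (⊤ : ℕ∞) + rs.length = d) (by simp)
      | coe k => exact ⟨k, rfl, by exact_mod_cast hdim⟩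
  refine subsingleton_ext_of_supportDim_lt M d hM (k + 1) (R ⧸ I ^ t) ?_ i (by omega)
  rw [hk] at hle
  exact hle.trans_lt (by exact_mod_cast k.lt_succ_self)

open Limits in
/-- If `Ext^c(-, M)` is represented by `W` on `I`-power torsion modules, then `H^c_I(M)` is the
`I`-power torsion part of `W`. -/
theorem exists_injective_localCohomology_of_natural_linearEquiv {R : Type} [CommRing R]
    (I : Ideal R) (c : ℕ) (M W : ModuleCat.{0} R)
    (φ : ∀ N : ModuleCat.{0} R, IsPowTorsion I N →
      (((Ext R (ModuleCat.{0} R) c).obj (op N)).obj M ≃ₗ[R] (N ⟶ W)))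
    (hφ : ∀ (N N' : ModuleCat.{0} R) (hN : IsPowTorsion I N) (hN' : IsPowTorsion I N')
      (g : N ⟶ N') (a : ((Ext R (ModuleCat.{0} R) c).obj (op N')).obj M),
        φ N hN (((Ext R (ModuleCat.{0} R) c).map g.op).app M a) = g ≫ φ N' hN' a) :
    ∃ α : (localCohomology I c).obj M →ₗ[R] W, Function.Injective α ∧
      IsPowTorsion I ((localCohomology I c).obj M) ∧
      ∀ w : W, (∃ t : ℕ, ∀ a ∈ I ^ t, a • w = 0) → w ∈ LinearMap.range α := by
  let D := localCohomology.diagram (localCohomology.idealPowersDiagram I) c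
  have hD : IsColimit (((evaluation (ModuleCat.{0} R) (ModuleCat.{0} R)).obj M).mapCocone
    (colimit.cocone D)) := isColimitOfPreserves _ (colimit.isColimit D)
  let ψ (t : ℕ) : ((Ext R (ModuleCat.{0} R) c).obj (op (ModuleCat.of R (R ⧸ I ^ t)))).obj M ≃ₗ[R]
    (ModuleCat.of R (R ⧸ I ^ t) ⟶ W) := φ (ModuleCat.of R (R ⧸ I ^ t)) (isPowTorsion_quotient I t)
  let β (t : ℕ) : ((Ext R (ModuleCat.{0} R) c).obj (op (ModuleCat.of R (R ⧸ I ^ t)))).obj M →ₗ[R]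
      W :=
    { toFun x := ψ t x (Ideal.Quotient.mk (I ^ t) 1)
      map_add' x y := by rw [map_add]; rfl
      map_smul' r x := by rw [map_smul]; rfl }
  let s : Cocone (D ⋙ (evaluation (ModuleCat.{0} R) (ModuleCat.{0} R)).obj M) :=
    { pt := W
      ι :=
        { app j := ModuleCat.ofHom (β j.unop.unop)
          naturality j k f := by
            ext x
            exact congr($(hφ _ _ (isPowTorsion_quotient I _) (isPowTorsion_quotient I _)
              ((localCohomology.ringModIdeals (localCohomology.idealPowersDiagram I)).map f.unop) x)
              (Ideal.Quotient.mk _ 1)) } }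
  let α : (localCohomology I c).obj M →ₗ[R] W := (hD.desc s).hom
  let ι (t : ℕ) : ((Ext R (ModuleCat.{0} R) c).obj (op (ModuleCat.of R (R ⧸ I ^ t)))).obj M →ₗ[R]
    (localCohomology I c).obj M := ((colimit.ι D (op (op t))).app M).hom
  have hα (t : ℕ) (x) : α (ι t x) = ψ t x (Ideal.Quotient.mk (I ^ t) 1) :=
    congr($(hD.fac s (op (op t))) x)
  have hι (h : (localCohomology I c).obj M) : ∃ t x, ι t x = h := by
    obtain ⟨j, x, hx⟩ := Concrete.isColimit_exists_rep _ hD h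
    exact ⟨j.unop.unop, x, hx⟩
  have hinj : Function.Injective α := by
    rw [injective_iff_map_eq_zero]
    intro h hh
    obtain ⟨t, x, rfl⟩ := hι h
    rw [hα] at hh
    suffices ψ t x = 0 by rw [(ψ t).map_eq_zero_iff.1 this, map_zero]
    refine ModuleCat.hom_ext (LinearMap.ext fun r ↦ ?_)
    obtain ⟨r, rfl⟩ := Ideal.Quotient.mk_surjective r
    have : Ideal.Quotient.mk (I ^ t) r = r • Ideal.Quotient.mk (I ^ t) 1 := by
      rw [Algebra.smul_def, map_one, mul_one]; rfl
    rw [this]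
    exact ((ψ t x).hom.map_smul _ _).trans ((congrArg (r • ·) hh).trans (smul_zero r))
  refine ⟨α, hinj, fun h ↦ ?_, ?_⟩
  · obtain ⟨t, x, rfl⟩ := hι h
    refine ⟨t, fun a ha ↦ hinj ?_⟩
    rw [map_smul, hα, map_zero]
    refine ((ψ t x).hom.map_smul _ _).symm.trans ((congrArg _ ?_).trans (map_zero (ψ t x).hom))
    exact Ideal.Quotient.eq_zero_iff_mem.2 (Ideal.mul_mem_right 1 _ ha)
  · rintro w ⟨t, ht⟩
    let g : (R ⧸ I ^ t) →ₗ[R] W :=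
      Submodule.liftQ (I ^ t) (LinearMap.toSpanSingleton R W w) fun a ha ↦ ht a ha
    refine ⟨ι t ((ψ t).symm (ModuleCat.ofHom g)), ?_⟩
    rw [hα, LinearEquiv.apply_symm_apply]
    exact one_smul R w

theorem nonempty_linearEquiv_end_of_injective {R H W : Type} [CommRing R] [AddCommGroup H]
    [Module R H] [AddCommGroup W] [Module R W] (I : Ideal R) (α : H →ₗ[R] W)
    (hα : Function.Injective α) (hH : IsPowTorsion I H)
    (hW : ∀ w : W, (∃ t : ℕ, ∀ a ∈ I ^ t, a • w = 0) → w ∈ LinearMap.range α) :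
    Nonempty ((H →ₗ[R] H) ≃ₗ[R] (H →ₗ[R] W)) := by
  refine ⟨LinearEquiv.ofBijective (α.compRight R) ⟨fun f g h ↦ ?_, fun g ↦ ?_⟩⟩
  · ext x
    exact hα congr($h x)
  · have hg (x : H) : g x ∈ LinearMap.range α := by
      obtain ⟨t, ht⟩ := hH x
      exact hW _ ⟨t, fun a ha ↦ by rw [← map_smul, ht a ha, map_zero]⟩
    refine ⟨(LinearEquiv.ofInjective α hα).symm.toLinearMap ∘ₗ g.codRestrict _ hg, ?_⟩
    ext x
    exact congrArg Subtype.val ((LinearEquiv.ofInjective α hα).apply_symm_apply ⟨g x, hg x⟩)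

/-- `Hom_R(H^c_I(ω_R), H^c_I(ω_R)) ≅ Ext^c_R(H^c_I(ω_R), ω_R)` as
`R`-modules. -/
theorem statement16 (d : ℕ) (hd : ringKrullDim R = (d : WithBot ℕ∞))
    (hCM : idealGrade (IsLocalRing.maximalIdeal R) = (d : ℕ∞))
    (ω : ModuleCat R) (hω : IsCanonicalModule R d ω)
    (I : Ideal R) (c : ℕ) (hc : idealGrade I = (c : ℕ∞))
    (hne : ¬ Subsingleton ((localCohomology I c).obj ω)) :
    Nonempty
      ((((localCohomology I c).obj ω) →ₗ[R] ((localCohomology I c).obj ω)) ≃ₗ[R]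
        (((Ext R (ModuleCat R) c).obj (op ((localCohomology I c).obj ω))).obj ω)) := by
  have : Module.Finite R ω := hω.1
  have hM (i : ℕ) (hi : i < d) : Subsingleton
      (Abelian.Ext (ModuleCat.of R (IsLocalRing.ResidueField R)) ω i) :=
    have := hω.2.1 i hi.ne
    (extLinearEquivExt _ ω i).symm.toEquiv.subsingleton
  obtain ⟨W, φ, hφ⟩ := exists_natural_ext_linearEquiv_hom I c ω
    (subsingleton_ext_quotient_pow ω d hd hM I c hc)
  obtain ⟨α, hα, hH, hW⟩ := exists_injective_localCohomology_of_natural_linearEquiv I c ω W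
    (fun N hN ↦ (extLinearEquivExt N ω c).trans (φ N hN)) fun N N' hN hN' g a ↦ by
      rw [LinearEquiv.trans_apply, LinearEquiv.trans_apply, extLinearEquivExt_naturality,
        hφ N N' hN hN']
  obtain ⟨e⟩ := nonempty_linearEquiv_end_of_injective I α hα hH hW
  exact ⟨e.trans (ModuleCat.homLinearEquiv.symm.trans
    ((extLinearEquivExt _ ω c).trans (φ _ hH)).symm)⟩
end
end

section
/- There is an isomorphism of R-modules Ext^c_R(H^c_I(ω_R), ω_R) ≅ Hom_R(H^{d−c}_𝔪(H^c_I(ω_R)), E), where E is the injective hull of the residue field 𝕜. -/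
open CategoryTheory Opposite

set_option synthInstance.maxHeartbeats 1000000
set_option maxHeartbeats 1000000

noncomputable section

universe u

section

/-- Yoneda `Ext` between unbundled modules. -/
abbrev ExtM (R : Type u) [CommRing R] (N M : Type u) [AddCommGroup N] [Module R N]
    [AddCommGroup M] [Module R M] (n : ℕ) : Type u :=
  Abelian.Ext.{u} (ModuleCat.of R N) (ModuleCat.of R M) n

namespace ExtM

open Abelian

section
variable {R : Type u} [CommRing R]
  {N N' N'' M M' M'' : Type u} [AddCommGroup N] [Module R N] [AddCommGroup N'] [Module R N']
  [AddCommGroup N''] [Module R N'']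
  [AddCommGroup M'] [Module R M'] [AddCommGroup M''] [Module R M''] [AddCommGroup M] [Module R M]

/-- Contravariant functoriality of `ExtM` in the first variable. -/
def pre (f : N →ₗ[R] N') (n : ℕ) : ExtM R N' M n →ₗ[R] ExtM R N M n where
  toFun e := (Ext.mk₀ (ModuleCat.ofHom f)).comp e (zero_add n)
  map_add' x y := by simp
  map_smul' r x := by simp

/-- Covariant functoriality of `ExtM` in the second variable. -/
def post (g : M →ₗ[R] M') (n : ℕ) : ExtM R N M n →ₗ[R] ExtM R N M' n where
  toFun e := e.comp (Ext.mk₀ (ModuleCat.ofHom g)) (add_zero n)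
  map_add' x y := by simp
  map_smul' r x := by simp

lemma pre_apply (f : N →ₗ[R] N') (n : ℕ) (e : ExtM R N' M n) :
    pre f n e = (Ext.mk₀ (ModuleCat.ofHom f)).comp e (zero_add n) := rfl

lemma post_apply (g : M →ₗ[R] M') (n : ℕ) (e : ExtM R N M n) :
    post g n e = e.comp (Ext.mk₀ (ModuleCat.ofHom g)) (add_zero n) := rfl

@[simp] lemma pre_id (n : ℕ) (e : ExtM R N M n) : pre LinearMap.id n e = e := by
  rw [pre_apply, ModuleCat.ofHom_id]; simp

lemma pre_pre (f : N →ₗ[R] N') (f' : N' →ₗ[R] N'') (n : ℕ) (e : ExtM R N'' M n) :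
    pre f n (pre f' n e) = pre (f' ∘ₗ f) n e := by
  simp only [pre_apply, ModuleCat.ofHom_comp]
  exact Ext.mk₀_comp_mk₀_assoc _ _ _

lemma post_post (g : M →ₗ[R] M') (g' : M' →ₗ[R] M'') (n : ℕ) (e : ExtM R N M n) :
    post g' n (post g n e) = post (g' ∘ₗ g) n e := by
  simp [post_apply, ModuleCat.ofHom_comp]

lemma pre_post (f : N →ₗ[R] N') (g : M →ₗ[R] M') (n : ℕ) (e : ExtM R N' M n) :
    pre f n (post g n e) = post g n (pre f n e) := by
  simp only [pre_apply, post_apply]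
  exact (Ext.comp_assoc _ _ _ (zero_add n) (add_zero n) (by simp)).symm

lemma pre_add (f g : N →ₗ[R] N') (n : ℕ) (e : ExtM R N' M n) :
    pre (f + g) n e = pre f n e + pre g n e := by
  simp [pre_apply, ModuleCat.ofHom_add, Ext.mk₀_add, Ext.add_comp]

lemma pre_smul (r : R) (f : N →ₗ[R] N') (n : ℕ) (e : ExtM R N' M n) :
    pre (r • f) n e = r • pre f n e := by
  have : ModuleCat.ofHom (r • f) = r • ModuleCat.ofHom f := rfl
  rw [pre_apply, this, Ext.mk₀_smul, Ext.smul_comp, pre_apply]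

@[simp] lemma pre_zero (n : ℕ) (e : ExtM R N' M n) :
    pre (0 : N →ₗ[R] N') n e = 0 := by
  simpa using pre_smul (0 : R) (0 : N →ₗ[R] N') n e

lemma post_add (f g : M →ₗ[R] M') (n : ℕ) (e : ExtM R N M n) :
    post (f + g) n e = post f n e + post g n e := by
  simp [post_apply, ModuleCat.ofHom_add, Ext.mk₀_add, Ext.comp_add]

lemma post_smul (r : R) (f : M →ₗ[R] M') (n : ℕ) (e : ExtM R N M n) :
    post (r • f) n e = r • post f n e := by
  have : ModuleCat.ofHom (r • f) = r • ModuleCat.ofHom f := rfl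
  rw [post_apply, this, Ext.mk₀_smul, Ext.comp_smul, post_apply]

lemma smul_eq_pre (r : R) (n : ℕ) (e : ExtM R N M n) :
    r • e = pre (r • LinearMap.id) n e := by rw [pre_smul, pre_id]

/-- Functoriality of `ExtM` for an isomorphism of first variables. -/
def preEquiv (f : N ≃ₗ[R] N') (n : ℕ) : ExtM R N' M n ≃ₗ[R] ExtM R N M n :=
  LinearEquiv.ofLinearMap (pre f.toLinearMap n) (pre f.symm.toLinearMap n)
    (by ext e; simp [pre_pre]) (by ext e; simp [pre_pre])

variable (R N M) in
/-- `Ext⁰` is `Hom`. -/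
def zeroEquiv : ExtM R N M 0 ≃ₗ[R] (N →ₗ[R] M) :=
  (Ext.linearEquiv₀ (R := R)).trans ModuleCat.homLinearEquiv

lemma zeroEquiv_symm_apply (f : N →ₗ[R] M) :
    (zeroEquiv R N M).symm f = Ext.mk₀ (ModuleCat.ofHom f) := rfl

lemma pre_zeroEquiv_symm (f : N →ₗ[R] N') (g : N' →ₗ[R] M) :
    pre f 0 ((zeroEquiv R N' M).symm g) = (zeroEquiv R N M).symm (g ∘ₗ f) := by
  simp [zeroEquiv_symm_apply, pre_apply, ModuleCat.ofHom_comp]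

lemma post_zeroEquiv_symm (f : N →ₗ[R] M) (g : M →ₗ[R] M') :
    post g 0 ((zeroEquiv R N M).symm f) = (zeroEquiv R N M').symm (g ∘ₗ f) := by
  simp [zeroEquiv_symm_apply, post_apply, ModuleCat.ofHom_comp]

lemma subsingleton_of_projective [Module.Projective R N] (n : ℕ) :
    Subsingleton (ExtM R N M (n + 1)) := by
  have : Projective (ModuleCat.of R N) := inferInstance
  exact ⟨fun a b ↦ by rw [a.eq_zero_of_projective, b.eq_zero_of_projective]⟩

end

section ses
variable {R : Type u} [CommRing R] {A B C M M' N N' : Type u} [AddCommGroup A] [Module R A]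
  [AddCommGroup B] [Module R B] [AddCommGroup C] [Module R C] [AddCommGroup M] [Module R M]
  [AddCommGroup N] [Module R N] [AddCommGroup M'] [Module R M'] [AddCommGroup N'] [Module R N']

variable (R A B C) in
/-- A short exact sequence of modules. -/
structure SES where
  f : A →ₗ[R] B
  g : B →ₗ[R] C
  inj : Function.Injective f
  exact : Function.Exact f g
  surj : Function.Surjective g

namespace SES

/-- The associated short complex. -/
def toSC (S : SES R A B C) : ShortComplex (ModuleCat.{u} R) :=
  ShortComplex.mk (ModuleCat.ofHom S.f) (ModuleCat.ofHom S.g)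
    (by rw [← ModuleCat.ofHom_comp, S.exact.linearMap_comp_eq_zero]; rfl)

lemma shortExact (S : SES R A B C) : S.toSC.ShortExact :=
  ModuleCat.shortComplex_shortExact S.toSC S.exact S.inj S.surj

/-- The class of a short exact sequence. -/
def cls (S : SES R A B C) : ExtM R C A 1 := S.shortExact.extClass

/-- The contravariant connecting map. -/
def δpre (S : SES R A B C) (n : ℕ) : ExtM R A M n →ₗ[R] ExtM R C M (n + 1) where
  toFun e := S.cls.comp e (add_comm 1 n)
  map_add' x y := by simp
  map_smul' r x := by simp

/-- The covariant connecting map. -/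
def δpost (S : SES R A B C) (n : ℕ) : ExtM R N C n →ₗ[R] ExtM R N A (n + 1) where
  toFun e := e.comp S.cls rfl
  map_add' x y := by simp
  map_smul' r x := by simp

lemma exact_pre₁ (S : SES R A B C) (n : ℕ) :
    Function.Exact (pre (M := M) S.f n) (S.δpre n) := fun e ↦
  ⟨fun h ↦ Ext.contravariant_sequence_exact₁ S.shortExact (ModuleCat.of R M) e (add_comm 1 n) h,
   by rintro ⟨x, rfl⟩; exact S.shortExact.extClass_comp_assoc x (h := add_comm 1 n)⟩

lemma exact_pre₂ (S : SES R A B C) (n : ℕ) :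
    Function.Exact (pre (M := M) S.g n) (pre S.f n) := fun e ↦
  ⟨fun h ↦ Ext.contravariant_sequence_exact₂ S.shortExact (ModuleCat.of R M) e h,
   by rintro ⟨x, rfl⟩; rw [pre_pre, S.exact.linearMap_comp_eq_zero, pre_zero]⟩

lemma exact_pre₃ (S : SES R A B C) (n : ℕ) :
    Function.Exact (S.δpre n) (pre (M := M) S.g (n + 1)) := fun e ↦
  ⟨fun h ↦ Ext.contravariant_sequence_exact₃ S.shortExact (ModuleCat.of R M) e h (add_comm 1 n),
   by rintro ⟨x, rfl⟩; exact S.shortExact.comp_extClass_assoc x (add_comm 1 n)⟩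

lemma exact_post₁ (S : SES R A B C) (n : ℕ) :
    Function.Exact (S.δpost n) (post (N := N) S.f (n + 1)) := fun e ↦
  ⟨fun h ↦ Ext.covariant_sequence_exact₁ (ModuleCat.of R N) S.shortExact e h rfl,
   by rintro ⟨x, rfl⟩
      refine (Ext.comp_assoc x S.cls (Ext.mk₀ (ModuleCat.ofHom S.f)) rfl (add_zero 1)
        (by simp)).trans ?_
      exact (congrArg (fun z ↦ Ext.comp x z rfl) S.shortExact.extClass_comp).trans
        (Ext.comp_zero _ _ _ _ _)⟩

lemma exact_post₃ (S : SES R A B C) (n : ℕ) :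
    Function.Exact (post (N := N) S.g n) (S.δpost n) := fun e ↦
  ⟨fun h ↦ Ext.covariant_sequence_exact₃ (ModuleCat.of R N) S.shortExact e rfl h,
   by rintro ⟨x, rfl⟩
      refine (Ext.comp_assoc x (Ext.mk₀ (ModuleCat.ofHom S.g)) S.cls (add_zero n) (zero_add 1)
        (by simp)).trans ?_
      exact (congrArg (fun z ↦ Ext.comp x z rfl) S.shortExact.comp_extClass).trans
        (Ext.comp_zero _ _ _ _ _)⟩

lemma pre_zero_injective (S : SES R A B C) : Function.Injective (pre (M := M) S.g 0) := by
  rw [injective_iff_map_eq_zero]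
  intro e he
  obtain ⟨g, rfl⟩ := (zeroEquiv R C M).symm.surjective e
  rw [pre_zeroEquiv_symm, map_eq_zero_iff _ (LinearEquiv.injective _)] at he
  have : g = 0 := by
    ext c; obtain ⟨b, rfl⟩ := S.surj c; exact DFunLike.congr_fun he b
  simp [this]

lemma δpre_post (S : SES R A B C) (g : M →ₗ[R] M') (n : ℕ) (e : ExtM R A M n) :
    S.δpre n (post g n e) = post g (n + 1) (S.δpre n e) := by
  exact (Ext.comp_assoc S.cls e (Ext.mk₀ (ModuleCat.ofHom g)) (add_comm 1 n) (add_zero n)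
    (by lia)).symm

lemma pre_δpost (S : SES R A B C) (g : N →ₗ[R] N') (n : ℕ) (e : ExtM R N' C n) :
    pre g (n + 1) (S.δpost n e) = S.δpost n (pre g n e) := by
  exact (Ext.comp_assoc (Ext.mk₀ (ModuleCat.ofHom g)) e S.cls (zero_add n) rfl (by simp)).symm

variable {A' B' C' : Type u} [AddCommGroup A'] [Module R A']
  [AddCommGroup B'] [Module R B'] [AddCommGroup C'] [Module R C']

lemma δpre_naturality (S : SES R A B C) (S' : SES R A' B' C') (a : A →ₗ[R] A') (b : B →ₗ[R] B')
    (c : C →ₗ[R] C') (h₁ : b ∘ₗ S.f = S'.f ∘ₗ a) (h₂ : c ∘ₗ S.g = S'.g ∘ₗ b) (n : ℕ)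
    (e : ExtM R A' M n) : S.δpre n (pre a n e) = pre c (n + 1) (S'.δpre n e) := by
  let φ : S.toSC ⟶ S'.toSC :=
    { τ₁ := ModuleCat.ofHom a
      τ₂ := ModuleCat.ofHom b
      τ₃ := ModuleCat.ofHom c
      comm₁₂ := by
        change ModuleCat.ofHom _ ≫ ModuleCat.ofHom _ = ModuleCat.ofHom _ ≫ ModuleCat.ofHom _
        rw [← ModuleCat.ofHom_comp, ← ModuleCat.ofHom_comp, h₁]
      comm₂₃ := by
        change ModuleCat.ofHom _ ≫ ModuleCat.ofHom _ = ModuleCat.ofHom _ ≫ ModuleCat.ofHom _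
        rw [← ModuleCat.ofHom_comp, ← ModuleCat.ofHom_comp, h₂] }
  have h := ShortComplex.ShortExact.extClass_naturality S.shortExact S'.shortExact φ
  refine (Ext.comp_assoc S.cls (Ext.mk₀ (ModuleCat.ofHom a)) e (add_zero 1) (zero_add n)
    (by lia)).symm.trans ?_
  refine (congrArg (fun z ↦ Ext.comp z e (add_comm 1 n)) h).trans ?_
  exact Ext.comp_assoc (Ext.mk₀ (ModuleCat.ofHom c)) S'.cls e (zero_add 1) (add_comm 1 n)
    (by lia)

end SES
end ses
end ExtM

end

section

namespace Koszul
open ExtM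

variable {R : Type u} [CommRing R]

/-- The ideal generated by the first `j` terms of a sequence. -/
def K (y : ℕ → R) : ℕ → Ideal R
  | 0 => ⊥
  | j + 1 => K y j ⊔ Ideal.span {y j}

@[simp] lemma K_zero (y : ℕ → R) : K y 0 = ⊥ := rfl

lemma K_succ (y : ℕ → R) (j : ℕ) : K y (j + 1) = K y j ⊔ Ideal.span {y j} := rfl

lemma K_le_succ (y : ℕ → R) (j : ℕ) : K y j ≤ K y (j + 1) := le_sup_left

lemma mem_K_succ (y : ℕ → R) (j : ℕ) : y j ∈ K y (j + 1) :=
  Ideal.mem_sup_right (Ideal.mem_span_singleton_self _)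

lemma mem_K (y : ℕ → R) {i j : ℕ} (h : i < j) : y i ∈ K y j := by
  induction j with
  | zero => lia
  | succ j ih =>
    obtain h | rfl := Nat.lt_succ_iff_lt_or_eq.mp h
    · exact K_le_succ y j (ih h)
    · exact mem_K_succ y i

lemma K_le {y : ℕ → R} {j : ℕ} {I : Ideal R} (h : ∀ i < j, y i ∈ I) : K y j ≤ I := by
  induction j with
  | zero => simp
  | succ j ih =>
    refine sup_le (ih fun i hi ↦ h i (by lia)) ?_
    rw [Ideal.span_le]
    simpa using h j (by lia)

lemma K_le_K {y y' z : ℕ → R} {j : ℕ} (h : ∀ i < j, y i = z i * y' i) : K y j ≤ K y' j :=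
  K_le fun i hi ↦ by rw [h i hi]; exact Ideal.mul_mem_left _ _ (mem_K _ hi)

/-- The `j`-th term is a nonzerodivisor on the quotient by the previous terms. -/
def RegAt (y : ℕ → R) (M : Type u) [AddCommGroup M] [Module R M] (j : ℕ) : Prop :=
  ∀ m : M, y j • m ∈ K y j • (⊤ : Submodule R M) → m ∈ K y j • (⊤ : Submodule R M)

lemma RegAt.mem {y : ℕ → R} {j : ℕ} (h : RegAt y R j) {a : R} (ha : y j * a ∈ K y j) :
    a ∈ K y j := by
  have := h a
  simpa [Ideal.mul_top] using this (by simpa using ha)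

/-- The projection between quotients by nested ideals. -/
abbrev fac {I J : Ideal R} (h : I ≤ J) : (R ⧸ I) →ₗ[R] (R ⧸ J) :=
  Submodule.mapQ I J LinearMap.id h

@[simp] lemma fac_refl {I : Ideal R} (h : I ≤ I) : fac h = LinearMap.id := by
  ext; rfl

lemma fac_comp {I J L : Ideal R} (h : I ≤ J) (h' : J ≤ L) :
    fac h' ∘ₗ fac h = fac (h.trans h') := by
  ext; rfl

/-- The exact sequence `0 → R/K_j → R/K_j → R/K_{j+1} → 0`. -/
def ses (y : ℕ → R) (j : ℕ) (h : RegAt y R j) :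
    SES R (R ⧸ K y j) (R ⧸ K y j) (R ⧸ K y (j + 1)) where
  f := y j • LinearMap.id
  g := fac (K_le_succ y j)
  inj := by
    rw [injective_iff_map_eq_zero]
    intro a
    obtain ⟨a, rfl⟩ := Ideal.Quotient.mk_surjective a
    intro ha
    rw [Ideal.Quotient.eq_zero_iff_mem]
    exact h.mem (Ideal.Quotient.eq_zero_iff_mem.mp ha)
  exact := by
    intro a
    obtain ⟨a, rfl⟩ := Ideal.Quotient.mk_surjective a
    constructor
    · intro ha
      have ha : a ∈ K y (j + 1) := Ideal.Quotient.eq_zero_iff_mem.mp ha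
      obtain ⟨b, hb, c, hc, rfl⟩ := Submodule.mem_sup.mp ha
      obtain ⟨c, rfl⟩ := Ideal.mem_span_singleton'.mp hc
      refine ⟨Ideal.Quotient.mk _ c, ?_⟩
      change Ideal.Quotient.mk _ (y j * c) = _
      rw [Ideal.Quotient.eq]
      have : y j * c - (b + c * y j) = -b := by ring
      rw [this]; exact neg_mem hb
    · rintro ⟨b, hb⟩
      obtain ⟨b, rfl⟩ := Ideal.Quotient.mk_surjective b
      rw [← hb]
      exact Ideal.Quotient.eq_zero_iff_mem.mpr
        (Ideal.mul_mem_right _ _ (mem_K_succ y j))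
  surj := by
    intro a
    obtain ⟨a, rfl⟩ := Ideal.Quotient.mk_surjective a
    exact ⟨Ideal.Quotient.mk _ a, rfl⟩

section
variable {M M' : Type u} [AddCommGroup M] [Module R M] [AddCommGroup M'] [Module R M']

open Classical in
/-- The Koszul generator of `Ext^j(R/K_j, R)`. -/
def κ (y : ℕ → R) : (j : ℕ) → ExtM R (R ⧸ K y j) R j
  | 0 => (zeroEquiv R (R ⧸ K y 0) R).symm (Submodule.quotEquivOfEqBot (K y 0) rfl).toLinearMap
  | j + 1 => if h : RegAt y R j then (ses y j h).δpre j (κ y j) else 0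

/-- The canonical map `M → Ext^j(R/K_j, M)`. -/
def kap (M : Type u) [AddCommGroup M] [Module R M] (y : ℕ → R) (j : ℕ) :
    M →ₗ[R] ExtM R (R ⧸ K y j) M j where
  toFun m := post (LinearMap.toSpanSingleton R M m) j (κ y j)
  map_add' m m' := by rw [LinearMap.toSpanSingleton_add, post_add]
  map_smul' r m := by rw [LinearMap.toSpanSingleton_smul, post_smul]; rfl

lemma kap_apply (y : ℕ → R) (j : ℕ) (m : M) :
    kap M y j m = post (LinearMap.toSpanSingleton R M m) j (κ y j) := rfl

lemma kap_succ (y : ℕ → R) (j : ℕ) (h : RegAt y R j) (m : M) :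
    kap M y (j + 1) m = (ses y j h).δpre j (kap M y j m) := by
  rw [kap_apply, kap_apply, κ, dif_pos h, SES.δpre_post]

lemma post_kap (y : ℕ → R) (j : ℕ) (g : M →ₗ[R] M') (m : M) :
    post g j (kap M y j m) = kap M' y j (g m) := by
  rw [kap_apply, kap_apply, post_post]
  congr 2
  ext; simp

lemma ext_subsingleton_of_gt (y : ℕ → R) (j : ℕ) (h : ∀ i < j, RegAt y R i) (n : ℕ) (hn : j < n) :
    Subsingleton (ExtM R (R ⧸ K y j) M n) := by
  induction j generalizing n with
  | zero =>
    obtain ⟨n, rfl⟩ : ∃ k, n = k + 1 := ⟨n - 1, by lia⟩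
    have : Module.Projective R (R ⧸ K y 0) :=
      Module.Projective.of_equiv (Submodule.quotEquivOfEqBot (K y 0) rfl).symm
    exact subsingleton_of_projective n
  | succ j ih =>
    obtain ⟨n, rfl⟩ : ∃ k, n = k + 1 := ⟨n - 1, by lia⟩
    have hj := h j (by lia)
    have ih := ih (fun i hi ↦ h i (by lia))
    have := ih n (by lia)
    have := ih (n + 1) (by lia)
    refine subsingleton_of_forall_eq 0 fun e ↦ ?_
    obtain ⟨x, rfl⟩ := ((ses y j hj).exact_pre₃ n e).mp (Subsingleton.elim _ _)
    rw [Subsingleton.elim x 0, map_zero]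

lemma kap_surjective (y : ℕ → R) (j : ℕ) (h : ∀ i < j, RegAt y R i) :
    Function.Surjective (kap M y j) := by
  induction j with
  | zero =>
    intro e
    obtain ⟨g, rfl⟩ := (zeroEquiv R _ M).symm.surjective e
    refine ⟨g (Ideal.Quotient.mk _ 1), ?_⟩
    rw [kap_apply, κ, post_zeroEquiv_symm]
    congr 1
    ext
    exact one_smul R _
  | succ j ih =>
    have hj := h j (by lia)
    have h' : ∀ i < j, RegAt y R i := fun i hi ↦ h i (by lia)
    intro e
    have := ext_subsingleton_of_gt (M := M) y j h' (j + 1) (by lia)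
    obtain ⟨x, rfl⟩ := ((ses y j hj).exact_pre₃ j e).mp (Subsingleton.elim _ _)
    obtain ⟨m, rfl⟩ := ih h' x
    exact ⟨m, kap_succ _ _ _ _⟩

lemma pre_ses_f (y : ℕ → R) (j : ℕ) (h : RegAt y R j) (n : ℕ) (e : ExtM R (R ⧸ K y j) M n) :
    pre (ses y j h).f n e = y j • e := by
  rw [smul_eq_pre]; rfl

lemma kap_eq_zero_iff (y : ℕ → R) (j : ℕ) (h : ∀ i < j, RegAt y R i) (m : M) :
    kap M y j m = 0 ↔ m ∈ K y j • (⊤ : Submodule R M) := by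
  induction j generalizing m with
  | zero =>
    rw [kap_apply, κ, post_zeroEquiv_symm, map_eq_zero_iff _ (LinearEquiv.injective _)]
    rw [show K y 0 • (⊤ : Submodule R M) = ⊥ from Submodule.bot_smul _, Submodule.mem_bot]
    constructor
    · intro h
      exact (one_smul R m).symm.trans (DFunLike.congr_fun h (Ideal.Quotient.mk (K y 0) 1))
    · rintro rfl
      rw [LinearMap.toSpanSingleton_zero, LinearMap.zero_comp]
  | succ j ih =>
    have hj := h j (by lia)
    have h' : ∀ i < j, RegAt y R i := fun i hi ↦ h i (by lia)
    rw [kap_succ y j hj, (ses y j hj).exact_pre₁ j,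
      show K y (j + 1) • (⊤ : Submodule R M) = K y j • ⊤ ⊔ Ideal.span {y j} • ⊤ from
        Submodule.sup_smul _ _ _, Submodule.mem_sup]
    constructor
    · rintro ⟨e, he⟩
      obtain ⟨m', rfl⟩ := kap_surjective y j h' e
      rw [pre_ses_f, ← map_smul, ← sub_eq_zero, ← map_sub, ih h'] at he
      refine ⟨m - y j • m', ?_, y j • m', ?_, by simp⟩
      · rw [← neg_sub]; exact neg_mem he
      · exact Submodule.smul_mem_smul (Ideal.mem_span_singleton_self _) trivial
    · rintro ⟨a, ha, b, hb, rfl⟩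
      obtain ⟨m', -, rfl⟩ := (Submodule.mem_smul_pointwise_iff_exists _ _ _).mp
        (by rwa [Submodule.ideal_span_singleton_smul] at hb)
      refine ⟨kap M y j m', ?_⟩
      rw [pre_ses_f, map_add, (ih h' a).mpr ha, zero_add, map_smul]

lemma pre_kap {y y' z : ℕ → R} (j : ℕ) (h : ∀ i < j, RegAt y R i) (h' : ∀ i < j, RegAt y' R i)
    (hz : ∀ i < j, y i = z i * y' i) (hle : K y j ≤ K y' j) (m : M) :
    pre (fac hle) j (kap M y' j m) = kap M y j ((∏ i ∈ Finset.range j, z i) • m) := by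
  induction j generalizing m with
  | zero =>
    have : fac hle = LinearMap.id := fac_refl _
    simp only [Finset.range_zero, Finset.prod_empty, one_smul]
    exact (congrArg (fun f ↦ pre f 0 (kap M y' 0 m)) this).trans (pre_id _ _)
  | succ j ih =>
    have hj := h j (by lia)
    have hj' := h' j (by lia)
    have hle' : K y j ≤ K y' j := K_le_K (z := z) fun i hi ↦ hz i (by lia)
    rw [kap_succ y' j hj', ← (ses y j hj).δpre_naturality (ses y' j hj') (z j • fac hle')
      (fac hle'), pre_smul, ih (fun i hi ↦ h i (by lia)) (fun i hi ↦ h' i (by lia))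
      (fun i hi ↦ hz i (by lia)), kap_succ y j hj, ← map_smul, smul_smul, Finset.prod_range_succ,
      mul_comm]
    · ext
      change Ideal.Quotient.mk _ (y j * 1) = Ideal.Quotient.mk _ (y' j * (z j * 1))
      rw [hz j (by lia)]; congr 1; ring
    · ext; rfl

lemma ext_subsingleton_of_lt (y : ℕ → R) (j : ℕ) (h : ∀ i < j, RegAt y R i)
    (hM : ∀ i < j, RegAt y M i) (n : ℕ) (hn : n < j) :
    Subsingleton (ExtM R (R ⧸ K y j) M n) := by
  induction j generalizing n with
  | zero => lia
  | succ j ih =>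
    have hj := h j (by lia)
    have h' : ∀ i < j, RegAt y R i := fun i hi ↦ h i (by lia)
    have ih := ih h' (fun i hi ↦ hM i (by lia))
    have hinj : Function.Injective (pre (M := M) (ses y j hj).g n) := by
      rcases n with _ | n
      · exact (ses y j hj).pre_zero_injective
      · rw [injective_iff_map_eq_zero]
        intro e he
        obtain ⟨x, rfl⟩ := ((ses y j hj).exact_pre₃ n e).mp he
        have := ih n (by lia)
        rw [Subsingleton.elim x 0, map_zero]
    refine subsingleton_of_forall_eq 0 fun e ↦ hinj ?_
    have h0 := ((ses y j hj).exact_pre₂ n _).mpr ⟨e, rfl⟩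
    rw [map_zero]
    obtain hn | rfl := Nat.lt_succ_iff_lt_or_eq.mp hn
    · have := ih n hn
      exact Subsingleton.elim _ _
    · generalize pre (ses y n hj).g n e = e' at h0
      obtain ⟨m, rfl⟩ := kap_surjective y n h' e'
      rw [pre_ses_f, ← map_smul, kap_eq_zero_iff _ _ h'] at h0
      exact (kap_eq_zero_iff _ _ h' _).mpr (hM n (by lia) m h0)

lemma RegAt.finsupp {y : ℕ → R} {j : ℕ} (h : RegAt y R j) (ι : Type u) : RegAt y (ι →₀ R) j := by
  have key : ∀ m : ι →₀ R, m ∈ K y j • (⊤ : Submodule R (ι →₀ R)) ↔ ∀ i, m i ∈ K y j := by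
    intro m
    constructor
    · intro hm i
      refine Submodule.smul_induction_on (p := fun m ↦ m i ∈ K y j) hm ?_ ?_
      · intro r hr n _
        simpa using Ideal.mul_mem_right _ _ hr
      · intro a b ha hb
        simpa using add_mem ha hb
    · intro hm
      rw [← m.sum_single]
      refine Submodule.sum_mem _ fun i _ ↦ ?_
      rw [← Finsupp.smul_single_one]
      exact Submodule.smul_mem_smul (hm i) trivial
  intro m hm
  rw [key] at hm ⊢
  exact fun i ↦ h.mem (hm i)

end
end Koszul

end

section

section RegularSequences
open RingTheory.Sequence
open scoped Pointwise

variable {R : Type u} [CommRing R]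

lemma RingTheory.Sequence.IsWeaklyRegular.of_exact (rs : List R) {A B C : Type u}
    [AddCommGroup A] [Module R A] [AddCommGroup B] [Module R B] [AddCommGroup C] [Module R C]
    (f : A →ₗ[R] B) (g : B →ₗ[R] C) (hf : Function.Injective f) (hfg : Function.Exact f g)
    (hg : Function.Surjective g) (hA : IsWeaklyRegular A rs) (hC : IsWeaklyRegular C rs) :
    IsWeaklyRegular B rs := by
  induction rs generalizing A B C with
  | nil => exact .nil R B
  | cons r rs ih =>
    rw [isWeaklyRegular_cons_iff] at hA hC ⊢
    have hex := QuotSMulTop.map_exact r hfg hg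
    have hinj : Function.Injective (QuotSMulTop.map r f) := by
      have h0 : Function.Exact (0 : PUnit.{u + 1} →ₗ[R] A) f := by
        rw [LinearMap.exact_zero_iff_injective]; exact hf
      have := QuotSMulTop.map_first_exact_on_four_term_exact_of_isSMulRegular_last h0 hfg hC.1
      rwa [map_zero, LinearMap.exact_zero_iff_injective] at this
    exact ⟨isSMulRegular_of_range_eq_ker hf hfg.linearMap_ker_eq.symm hA.1 hC.1,
      ih _ _ hinj hex (QuotSMulTop.map_surjective r hg) hA.2 hC.2⟩

/-- The exact sequence `M/r^t M → M/r^{t+1} M → M/r M`. -/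
lemma isWeaklyRegular_quotSMulTop_pow {M : Type u} [AddCommGroup M] [Module R M] {r : R}
    {rs : List R} (hr : IsSMulRegular M r) (h : IsWeaklyRegular (QuotSMulTop r M) rs) (t : ℕ) :
    IsWeaklyRegular (QuotSMulTop (r ^ t) M) rs := by
  induction t with
  | zero =>
    have : Subsingleton (QuotSMulTop (r ^ 0) M) := by
      rw [Submodule.Quotient.subsingleton_iff, pow_zero, one_smul]
    exact (isWeaklyRegular_iff_Fin _ _).mpr fun i ↦ by
      intro a b _
      obtain ⟨a, rfl⟩ := Submodule.Quotient.mk_surjective _ a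
      obtain ⟨b, rfl⟩ := Submodule.Quotient.mk_surjective _ b
      rw [Subsingleton.elim a b]
  | succ t ih =>
    have hle : (r ^ t • ⊤ : Submodule R M) ≤ (r ^ (t + 1) • ⊤ : Submodule R M).comap
        (r • LinearMap.id) := by
      intro m hm
      obtain ⟨m, -, rfl⟩ := (Submodule.mem_smul_pointwise_iff_exists _ _ _).mp hm
      refine (Submodule.mem_smul_pointwise_iff_exists _ _ _).mpr ⟨m, trivial, ?_⟩
      simp [smul_smul, pow_succ]
    have hle' : (r ^ (t + 1) • ⊤ : Submodule R M) ≤ (r • ⊤ : Submodule R M).comap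
        LinearMap.id := by
      intro m hm
      obtain ⟨m, -, rfl⟩ := (Submodule.mem_smul_pointwise_iff_exists _ _ _).mp hm
      refine (Submodule.mem_smul_pointwise_iff_exists _ _ _).mpr ⟨r ^ t • m, trivial, ?_⟩
      simp [smul_smul, pow_succ']
    refine .of_exact rs (Submodule.mapQ _ _ (r • LinearMap.id) hle)
      (Submodule.mapQ _ _ LinearMap.id hle') ?_ ?_ ?_ ih h
    · rw [injective_iff_map_eq_zero]
      intro a ha
      obtain ⟨a, rfl⟩ := Submodule.Quotient.mk_surjective _ a
      rw [Submodule.mapQ_apply, Submodule.Quotient.mk_eq_zero,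
        Submodule.mem_smul_pointwise_iff_exists] at ha
      obtain ⟨b, -, hb⟩ := ha
      rw [Submodule.Quotient.mk_eq_zero, Submodule.mem_smul_pointwise_iff_exists]
      refine ⟨b, trivial, hr ?_⟩
      simpa [smul_smul, pow_succ'] using hb
    · intro a
      obtain ⟨a, rfl⟩ := Submodule.Quotient.mk_surjective _ a
      rw [Submodule.mapQ_apply, Submodule.Quotient.mk_eq_zero,
        Submodule.mem_smul_pointwise_iff_exists]
      constructor
      · rintro ⟨b, -, hb⟩
        refine ⟨Submodule.Quotient.mk b, ?_⟩
        rw [Submodule.mapQ_apply]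
        exact congrArg _ hb
      · rintro ⟨b, hb⟩
        obtain ⟨b, rfl⟩ := Submodule.Quotient.mk_surjective _ b
        rw [Submodule.mapQ_apply, Submodule.Quotient.eq] at hb
        obtain ⟨c, -, hc⟩ := (Submodule.mem_smul_pointwise_iff_exists _ _ _).mp hb
        refine ⟨b - r ^ t • c, trivial, ?_⟩
        have hc : r ^ (t + 1) • c = r • b - a := hc
        rw [smul_sub, smul_smul, ← pow_succ', hc]
        simp
    · intro a
      obtain ⟨a, rfl⟩ := Submodule.Quotient.mk_surjective _ a
      exact ⟨Submodule.Quotient.mk a, rfl⟩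

lemma RingTheory.Sequence.IsWeaklyRegular.map_pow {M : Type u} [AddCommGroup M] [Module R M]
    {rs : List R} (h : IsWeaklyRegular M rs) (t : ℕ) : IsWeaklyRegular M (rs.map (· ^ t)) := by
  induction rs generalizing M with
  | nil => exact h
  | cons r rs ih =>
    rw [List.map_cons, isWeaklyRegular_cons_iff]
    rw [isWeaklyRegular_cons_iff] at h
    exact ⟨h.1.pow t, ih (isWeaklyRegular_quotSMulTop_pow h.1 h.2 t)⟩

namespace Koszul

lemma K_eq_ofList (rs : List R) (y : ℕ → R) (h : ∀ i (hi : i < rs.length), y i = rs[i]) (j : ℕ)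
    (hj : j ≤ rs.length) : K y j = Ideal.ofList (rs.take j) := by
  induction j with
  | zero => simp
  | succ j ih =>
    rw [K_succ, ih (by lia), List.take_add_one, Ideal.ofList_append,
      List.getElem?_eq_getElem (by lia), h j (by lia)]
    simp

lemma regAt_of_isWeaklyRegular (rs : List R) (y : ℕ → R)
    (h : ∀ i (hi : i < rs.length), y i = rs[i]) (hreg : IsWeaklyRegular R rs) (j : ℕ)
    (hj : j < rs.length) : RegAt y R j := by
  intro a ha
  have := (isWeaklyRegular_iff_Fin _ _).mp hreg ⟨j, hj⟩
  rw [K_eq_ofList rs y h j hj.le, h j hj] at ha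
  rw [K_eq_ofList rs y h j hj.le]
  rw [← Submodule.Quotient.mk_eq_zero] at ha ⊢
  exact this.right_eq_zero_of_smul ha

end Koszul

end RegularSequences

section CohenMacaulay
open RingTheory.Sequence Koszul IsLocalRing

variable {R : Type} [CommRing R]

lemma RingTheory.Sequence.IsRegular.mem_maximalIdeal [IsLocalRing R] {rs : List R}
    (h : IsRegular R rs) : ∀ r ∈ rs, r ∈ maximalIdeal R := by
  intro r hr
  refine le_maximalIdeal (J := Ideal.ofList rs) ?_ (Ideal.subset_span hr)
  intro h'
  apply h.top_ne_smul
  simp [h']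

lemma idealGrade_le_maximalIdeal [IsLocalRing R] (I : Ideal R) :
    idealGrade I ≤ idealGrade (maximalIdeal R) := by
  apply sSup_le_sSup
  rintro c ⟨rs, -, h, rfl⟩
  exact ⟨rs, h.mem_maximalIdeal, h, rfl⟩

lemma exists_isRegular_of_idealGrade_eq_s17 (I : Ideal R) [Nontrivial R] {d : ℕ}
    (h : idealGrade I = d) : ∃ rs : List R, IsRegular R rs ∧ rs.length = d := by
  have : Nonempty {c : ℕ∞ | ∃ rs : List R, (∀ r ∈ rs, r ∈ I) ∧
    IsRegular R rs ∧ (rs.length : ℕ∞) = c} := ⟨0, [], by simp, .nil R R, by simp⟩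
  have := ENat.sSup_mem_of_nonempty_of_lt_top (s := {c : ℕ∞ | ∃ rs : List R, (∀ r ∈ rs, r ∈ I) ∧
    IsRegular R rs ∧ (rs.length : ℕ∞) = c})
    (by change idealGrade I < ⊤; rw [h]; exact ENat.natCast_lt_top d)
  obtain ⟨rs, -, hrs, hl⟩ := this
  refine ⟨rs, hrs, ?_⟩
  have h2 : (rs.length : ℕ∞) = d := hl.trans h
  exact_mod_cast h2

lemma maximalIdeal_le_radical_ofList [IsLocalRing R] [IsNoetherianRing R] {rs : List R}
    (h : IsRegular R rs) (hd : ringKrullDim R = rs.length) :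
    maximalIdeal R ≤ (Ideal.ofList rs).radical := by
  have hne : Ideal.ofList rs ≠ ⊤ := fun h' ↦ h.top_ne_smul (by simp [h'])
  have : Nontrivial (R ⧸ Ideal.ofList rs) := Ideal.Quotient.nontrivial_iff.mpr hne
  have h0 : ringKrullDim (R ⧸ Ideal.ofList rs) = 0 := by
    have := ringKrullDim_add_length_eq_ringKrullDim_of_isRegular rs h
    rw [hd] at this
    generalize ringKrullDim (R ⧸ Ideal.ofList rs) = z at this
    induction z with
    | bot => simp at this
    | coe z =>
      have h2 : z + (rs.length : ℕ∞) = (rs.length : ℕ∞) := by exact_mod_cast this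
      have : z = 0 := by
        induction z with
        | top => simp at h2
        | coe z =>
          have : z + rs.length = rs.length := by exact_mod_cast h2
          have : z = 0 := by lia
          simp [this]
      simp [this]
  have : Ring.KrullDimLE 0 (R ⧸ Ideal.ofList rs) :=
    ringKrullDimZero_iff_ringKrullDim_eq_zero.mpr h0
  have : IsLocalRing (R ⧸ Ideal.ofList rs) :=
    .of_surjective' (Ideal.Quotient.mk _) Ideal.Quotient.mk_surjective
  have hloc : IsLocalHom (Ideal.Quotient.mk (Ideal.ofList rs)) :=
    .of_surjective _ Ideal.Quotient.mk_surjective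
  intro a ha
  have : IsNilpotent (Ideal.Quotient.mk (Ideal.ofList rs) a) := by
    rw [Ring.KrullDimLE.isNilpotent_iff_mem_maximalIdeal]
    exact map_nonunit _ a ha
  obtain ⟨n, hn⟩ := this
  exact ⟨n, by rwa [← map_pow, Ideal.Quotient.eq_zero_iff_mem] at hn⟩

/-- A Cohen-Macaulay local ring has a system of parameters all of whose powers are
regular sequences. -/
lemma exists_regular_parameters [IsLocalRing R] [IsNoetherianRing R] {d : ℕ}
    (hd : ringKrullDim R = d) (hCM : idealGrade (maximalIdeal R) = d) :
    ∃ x : ℕ → R, (∀ t, ∀ i < d, RegAt (fun i ↦ x i ^ t) R i) ∧ (∀ i, x i ∈ maximalIdeal R) ∧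
      ∀ t, ∃ n, maximalIdeal R ^ n ≤ K (fun i ↦ x i ^ t) d := by
  obtain ⟨rs, hrs, rfl⟩ := exists_isRegular_of_idealGrade_eq_s17 _ hCM
  have hx : ∀ i (hi : i < rs.length), rs.getD i 0 = rs[i] := fun i hi ↦ by simp [hi]
  refine ⟨fun i ↦ rs.getD i 0, fun t i hi ↦ ?_, fun i ↦ ?_, fun t ↦ ?_⟩
  · refine regAt_of_isWeaklyRegular (rs.map (· ^ t)) _ (fun i hi ↦ ?_)
      (hrs.toIsWeaklyRegular.map_pow t) i (by simpa using hi)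
    have : i < rs.length := by simpa using hi
    simp [this]
  · change rs.getD i 0 ∈ _
    by_cases hi : i < rs.length
    · rw [hx i hi]; exact hrs.mem_maximalIdeal _ (List.getElem_mem hi)
    · rw [List.getD_eq_default _ _ (not_lt.mp hi)]; exact zero_mem _
  · refine Ideal.exists_pow_le_of_le_radical_of_fg
      ((maximalIdeal_le_radical_ofList hrs hd).trans ?_) (IsNoetherian.noetherian _)
    have := K_eq_ofList rs _ hx _ le_rfl
    rw [List.take_length] at this
    rw [← this, ← Ideal.radical_idem (K (fun i ↦ rs.getD i 0 ^ t) rs.length)]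
    exact Ideal.radical_mono (K_le fun i hi ↦ ⟨t, mem_K (fun i ↦ rs.getD i 0 ^ t) hi⟩)

end CohenMacaulay

end

section

section Generic

variable {R : Type*} [CommRing R] {Z A B : Type*} [AddCommGroup Z] [AddCommGroup A] [AddCommGroup B]
  [Module R Z] [Module R A] [Module R B]

/-- The isomorphism between the targets of two surjections with the same kernel. -/
def LinearEquiv.ofSurjectiveOfKer (p : Z →ₗ[R] A) (q : Z →ₗ[R] B) (hp : Function.Surjective p)
    (hq : Function.Surjective q) (h : LinearMap.ker p = LinearMap.ker q) : A ≃ₗ[R] B :=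
  (p.quotKerEquivOfSurjective hp).symm ≪≫ₗ Submodule.quotEquivOfEq _ _ h ≪≫ₗ
    q.quotKerEquivOfSurjective hq

lemma LinearEquiv.ofSurjectiveOfKer_apply (p : Z →ₗ[R] A) (q : Z →ₗ[R] B)
    (hp : Function.Surjective p) (hq : Function.Surjective q)
    (h : LinearMap.ker p = LinearMap.ker q) (z : Z) :
    LinearEquiv.ofSurjectiveOfKer p q hp hq h (p z) = q z := by
  have : (p.quotKerEquivOfSurjective hp).symm (p z) = (LinearMap.ker p).mkQ z := by
    rw [LinearEquiv.symm_apply_eq]; rfl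
  simp only [LinearEquiv.ofSurjectiveOfKer, LinearEquiv.trans_apply, this]
  rfl

end Generic

namespace CategoryTheory.ShortComplex

variable {R : Type u} [CommRing R] (S : ShortComplex (ModuleCat.{u} R))

/-- The projection from the cycles of a complex of modules to its homology. -/
def kerToHomology : LinearMap.ker S.g.hom →ₗ[R] S.homology :=
  (S.moduleCatCyclesIso.inv ≫ S.homologyπ).hom

lemma kerToHomology_surjective : Function.Surjective S.kerToHomology := by
  have : Epi (S.moduleCatCyclesIso.inv ≫ S.homologyπ) := inferInstance
  exact (ModuleCat.epi_iff_surjective _).1 this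

lemma kerToHomology_eq_zero_iff (z : LinearMap.ker S.g.hom) :
    S.kerToHomology z = 0 ↔ ∃ x, S.f.hom x = z.1 := by
  have h : S.kerToHomology z = S.moduleCatHomologyIso.inv.hom
      ((LinearMap.range S.moduleCatToCycles).mkQ z) := by
    rw [kerToHomology, moduleCatCyclesIso_inv_π]
    rfl
  have hinj : Function.Injective S.moduleCatHomologyIso.inv.hom :=
    (ModuleCat.mono_iff_injective _).1 inferInstance
  rw [h]
  refine (map_eq_zero_iff _ hinj).trans ((Submodule.Quotient.mk_eq_zero _).trans ?_)
  rw [LinearMap.mem_range]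
  exact ⟨fun ⟨x, hx⟩ ↦ ⟨x, congrArg Subtype.val hx⟩, fun ⟨x, hx⟩ ↦ ⟨x, Subtype.ext hx⟩⟩

lemma kerToHomology_naturality {S T : ShortComplex (ModuleCat.{u} R)} (φ : S ⟶ T)
    (z : LinearMap.ker S.g.hom) (w : LinearMap.ker T.g.hom) (h : φ.τ₂.hom z.1 = w.1) :
    (homologyMap φ).hom (S.kerToHomology z) = T.kerToHomology w := by
  have hz : (cyclesMap φ).hom (S.moduleCatCyclesIso.inv.hom z) =
      T.moduleCatCyclesIso.inv.hom w := by
    apply (ModuleCat.mono_iff_injective T.iCycles).1 inferInstance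
    have h1 : (cyclesMap φ ≫ T.iCycles).hom (S.moduleCatCyclesIso.inv.hom z) = φ.τ₂.hom z.1 := by
      rw [cyclesMap_i, ModuleCat.hom_comp, LinearMap.comp_apply]
      congr 1
      exact LinearMap.congr_fun (congrArg ModuleCat.Hom.hom S.moduleCatCyclesIso_inv_iCycles) z
    exact (h1.trans h).trans
      (LinearMap.congr_fun (congrArg ModuleCat.Hom.hom T.moduleCatCyclesIso_inv_iCycles) w).symm
  have := LinearMap.congr_fun (congrArg ModuleCat.Hom.hom (homologyπ_naturality φ))
    (S.moduleCatCyclesIso.inv.hom z)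
  refine this.trans ?_
  simp only [ModuleCat.hom_comp, LinearMap.comp_apply]
  rw [hz]
  rfl

end CategoryTheory.ShortComplex

namespace CategoryTheory.ProjectiveResolution

variable {R : Type u} [CommRing R] {X : ModuleCat.{u} R} (P : ProjectiveResolution X)
  (Y : ModuleCat.{u} R) (n : ℕ)

/-- The short complex `Hom(P_{n-1}, Y) ⟶ Hom(P_n, Y) ⟶ Hom(P_{n+1}, Y)`. -/
abbrev homSC : ShortComplex (ModuleCat.{u} R) := (P.complex.linearYonedaObj R Y).sc n

/-- A cocycle, seen as a morphism. -/
def cocycleHom (z : LinearMap.ker (P.homSC Y n).g.hom) : P.complex.X n ⟶ Y := z.1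

lemma cocycleHom_comp (z : LinearMap.ker (P.homSC Y n).g.hom) :
    P.complex.d ((ComplexShape.up ℕ).next n) n ≫ P.cocycleHom Y n z = 0 := z.2

lemma add_one_eq_next (n : ℕ) : n + 1 = (ComplexShape.up ℕ).next n :=
  (CochainComplex.next ℕ n).symm

/-- The class in `Ext` of a cocycle in a projective resolution. -/
def extMkₗ : LinearMap.ker (P.homSC Y n).g.hom →ₗ[R] Abelian.Ext X Y n where
  toFun z := P.extMk (P.cocycleHom Y n z) _ (add_one_eq_next n) (P.cocycleHom_comp Y n z)
  map_add' z w := (P.add_extMk _ _ _ _ _ _).symm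
  map_smul' r z := by
    rw [RingHom.id_apply, Abelian.Ext.smul_eq_comp_mk₀, extMk_comp_mk₀]
    rfl

lemma extMkₗ_surjective : Function.Surjective (P.extMkₗ Y n) := by
  intro α
  obtain ⟨f, hf, rfl⟩ := P.extMk_surjective α _ (add_one_eq_next n)
  exact ⟨⟨f, hf⟩, rfl⟩

lemma extMk_zero_eq_zero_iff (f : P.complex.X 0 ⟶ Y) (m : ℕ) (hm : 0 + 1 = m)
    (hf : P.complex.d m 0 ≫ f = 0) : P.extMk f m hm hf = 0 ↔ f = 0 := by
  have := HasDerivedCategory.standard (ModuleCat.{u} R)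
  simp only [← P.extEquivCohomologyClass.apply_eq_iff_eq,
    extEquivCohomologyClass_extMk, extEquivCohomologyClass_zero,
    CochainComplex.HomComplex.CohomologyClass.mk_eq_zero_iff]
  rw [CochainComplex.HomComplex.Cocycle.toSingleMk_mem_coboundaries_iff _ _ _ _ _ 1 (by lia)]
  have h1 : P.cochainComplex.d (-((0 : ℕ) : ℤ)) 1 = 0 :=
    (CochainComplex.isZero_of_isStrictlyLE P.cochainComplex 0 1).eq_of_tgt _ _
  have h2 : ((P.cochainComplexXIso (-((0 : ℕ) : ℤ)) 0 rfl).hom ≫ f = 0) ↔ f = 0 := by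
    rw [← cancel_epi (P.cochainComplexXIso (-((0 : ℕ) : ℤ)) 0 rfl).hom, Limits.comp_zero]
  rw [h1]
  simp only [Limits.zero_comp]
  exact ⟨fun ⟨_, h⟩ ↦ h2.1 h.symm, fun h ↦ ⟨0, (h2.2 h).symm⟩⟩

lemma extMkₗ_eq_zero_iff (z : LinearMap.ker (P.homSC Y n).g.hom) :
    P.extMkₗ Y n z = 0 ↔ ∃ x, (P.homSC Y n).f.hom x = z.1 := by
  cases n with
  | zero =>
    refine (P.extMk_zero_eq_zero_iff Y (P.cocycleHom Y 0 z) _ (add_one_eq_next 0)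
      (P.cocycleHom_comp Y 0 z)).trans ?_
    have h0 : (P.homSC Y 0).f = 0 :=
      HomologicalComplex.shape (P.complex.linearYonedaObj R Y) _ _ (by simp)
    rw [h0]
    exact ⟨fun h ↦ ⟨0, h.symm⟩, fun ⟨x, hx⟩ ↦ hx.symm⟩
  | succ p =>
    refine (P.extMk_eq_zero_iff (P.cocycleHom Y (p + 1) z) _ (add_one_eq_next (p + 1))
      (P.cocycleHom_comp Y (p + 1) z) ((ComplexShape.up ℕ).prev (p + 1)) (by simp)).trans ?_
    exact Iff.rfl

/-- The class in the derived functor `Ext` of a cocycle in a projective resolution. -/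
def derivedMk : LinearMap.ker (P.homSC Y n).g.hom →ₗ[R]
    ((Ext R (ModuleCat.{u} R) n).obj (op X)).obj Y :=
  (P.isoExt (R := R) n Y).inv.hom ∘ₗ (P.homSC Y n).kerToHomology

lemma derivedMk_surjective : Function.Surjective (P.derivedMk Y n) :=
  ((ModuleCat.epi_iff_surjective (P.isoExt (R := R) n Y).inv).1 inferInstance).comp
    (P.homSC Y n).kerToHomology_surjective

lemma derivedMk_eq_zero_iff (z : LinearMap.ker (P.homSC Y n).g.hom) :
    P.derivedMk Y n z = 0 ↔ ∃ x, (P.homSC Y n).f.hom x = z.1 := by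
  have hinj : Function.Injective (P.isoExt (R := R) n Y).inv.hom :=
    (ModuleCat.mono_iff_injective _).1 inferInstance
  exact (map_eq_zero_iff _ hinj).trans ((P.homSC Y n).kerToHomology_eq_zero_iff z)

/-- The comparison between the two definitions of `Ext`. -/
def extComparison : ((Ext R (ModuleCat.{u} R) n).obj (op X)).obj Y ≃ₗ[R] Abelian.Ext X Y n :=
  LinearEquiv.ofSurjectiveOfKer (P.derivedMk Y n) (P.extMkₗ Y n) (P.derivedMk_surjective Y n)
    (P.extMkₗ_surjective Y n) (by
      ext z
      rw [LinearMap.mem_ker, LinearMap.mem_ker, derivedMk_eq_zero_iff, extMkₗ_eq_zero_iff])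

lemma extComparison_derivedMk (z : LinearMap.ker (P.homSC Y n).g.hom) :
    P.extComparison Y n (P.derivedMk Y n z) = P.extMkₗ Y n z :=
  LinearEquiv.ofSurjectiveOfKer_apply _ _ _ _ _ z

variable {X' : ModuleCat.{u} R} (Q : ProjectiveResolution X') (g : X ⟶ X')

lemma exists_hom_lift : Nonempty (ProjectiveResolution.Hom P Q g) :=
  ⟨{  hom := ProjectiveResolution.lift g P Q
      hom_f_zero_comp_π_f_zero := by
        have := ProjectiveResolution.lift_commutes g P Q
        exact HomologicalComplex.congr_hom this 0 }⟩

/-- Precomposition of cocycles with a chain map. -/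
def homSCMap (φ : P.complex ⟶ Q.complex) : Q.homSC Y n ⟶ P.homSC Y n :=
  (HomologicalComplex.shortComplexFunctor _ _ n).map ((HomologicalComplex.unopFunctor _ _).map
    (((((linearYoneda R (ModuleCat.{u} R)).obj Y).rightOp.mapHomologicalComplex _).map φ)).op)

variable {P Q}

lemma homologyMap_homSCMap_isoExt_inv (φ : Hom P Q g) :
    (Q.isoExt (R := R) n Y).inv ≫ ((Ext R (ModuleCat.{u} R) n).map g.op).app Y =
      ShortComplex.homologyMap (homSCMap P Y n Q φ.hom) ≫ (P.isoExt (R := R) n Y).inv := by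
  let F := ((linearYoneda R (ModuleCat.{u} R)).obj Y).rightOp
  have h1 := congrArg Quiver.Hom.unop
    (isoLeftDerivedObj_hom_naturality g P Q φ.hom φ.hom_f_zero_comp_π_f_zero F n)
  have h2 := congrArg Quiver.Hom.unop (HomologicalComplex.homologyOp_hom_naturality
    ((HomologicalComplex.unopFunctor _ _).map ((F.mapHomologicalComplex _).map φ.hom).op) n)
  have e1 : (Q.isoExt (R := R) n Y).inv =
    (HomologicalComplex.homologyUnop ((F.mapHomologicalComplex _).obj Q.complex) n).hom ≫
      (Q.isoLeftDerivedObj F n).hom.unop := rfl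
  have e2 : (P.isoExt (R := R) n Y).inv =
    (HomologicalComplex.homologyUnop ((F.mapHomologicalComplex _).obj P.complex) n).hom ≫
      (P.isoLeftDerivedObj F n).hom.unop := rfl
  rw [e1, e2]
  refine (Category.assoc _ _ _).trans ((congrArg (fun t ↦ _ ≫ t) h1).trans ?_)
  refine (Category.assoc _ _ _).symm.trans
    ((congrArg (fun t ↦ t ≫ (P.isoLeftDerivedObj F n).hom.unop) h2).trans ?_)
  exact Category.assoc _ _ _

/-- Precomposition of cocycles with a chain map, on elements. -/
def cocycleMap (φ : P.complex ⟶ Q.complex) (z : LinearMap.ker (Q.homSC Y n).g.hom) :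
    LinearMap.ker (P.homSC Y n).g.hom :=
  ⟨(homSCMap P Y n Q φ).τ₂.hom z.1, by
    have := LinearMap.congr_fun (congrArg ModuleCat.Hom.hom (homSCMap P Y n Q φ).comm₂₃) z.1
    refine LinearMap.mem_ker.2 (this.trans ?_)
    exact (congrArg (homSCMap P Y n Q φ).τ₃.hom z.2).trans (map_zero _)⟩

lemma extComparison_naturality (P : ProjectiveResolution X) (Q : ProjectiveResolution X')
    (e : ((Ext R (ModuleCat.{u} R) n).obj (op X')).obj Y) :
    P.extComparison Y n ((((Ext R (ModuleCat.{u} R) n).map g.op).app Y).hom e) =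
      (Abelian.Ext.mk₀ g).comp (Q.extComparison Y n e) (zero_add n) := by
  obtain ⟨φ⟩ := exists_hom_lift P Q g
  obtain ⟨z, rfl⟩ := Q.derivedMk_surjective Y n e
  rw [extComparison_derivedMk]
  have h1 : (((Ext R (ModuleCat.{u} R) n).map g.op).app Y).hom (Q.derivedMk Y n z) =
      P.derivedMk Y n (cocycleMap Y n φ.hom z) := by
    refine (LinearMap.congr_fun (congrArg ModuleCat.Hom.hom
      (homologyMap_homSCMap_isoExt_inv Y n g φ)) ((Q.homSC Y n).kerToHomology z)).trans ?_
    exact congrArg (P.isoExt (R := R) n Y).inv.hom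
      (ShortComplex.kerToHomology_naturality (homSCMap P Y n Q φ.hom) z _ rfl)
  rw [h1, extComparison_derivedMk]
  exact (Q.mk₀_comp_extMk _ _ (add_one_eq_next n) (Q.cocycleHom_comp Y n z) φ).symm

end CategoryTheory.ProjectiveResolution

end

section

open Koszul (fac)
open ExtM

variable {R : Type u} [CommRing R]

/-- The two definitions of `Ext` agree. -/
def ExtM.ofDerived (N M : ModuleCat.{u} R) (n : ℕ) :
    ((Ext R (ModuleCat.{u} R) n).obj (op N)).obj M ≃ₗ[R] ExtM R N M n :=
  (projectiveResolution N).extComparison M n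

lemma ExtM.ofDerived_naturality {N N' : Type u} [AddCommGroup N] [Module R N] [AddCommGroup N']
    [Module R N'] (M : ModuleCat.{u} R) (n : ℕ) (f : N →ₗ[R] N')
    (e : ((Ext R (ModuleCat.{u} R) n).obj (op (ModuleCat.of R N'))).obj M) :
    ofDerived (ModuleCat.of R N) M n
        ((((Ext R (ModuleCat.{u} R) n).map (ModuleCat.ofHom f).op).app M).hom e) =
      pre f n (ofDerived (ModuleCat.of R N') M n e) :=
  ProjectiveResolution.extComparison_naturality M n (ModuleCat.ofHom f) _ _ e

section LC

variable {J : ℕ → Ideal R} (hJ : Antitone J) (M : Type u) [AddCommGroup M] [Module R M] (n : ℕ)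

/-- The transition maps of the system `Ext^n(R / J t, M)`. -/
abbrev LC.trans (s t : ℕ) (h : s ≤ t) : ExtM R (R ⧸ J s) M n →ₗ[R] ExtM R (R ⧸ J t) M n :=
  pre (fac (hJ h)) n

/-- The direct limit of `Ext^n(R / J t, M)`. -/
def LC : Type u :=
  Module.DirectLimit (fun t ↦ ExtM R (R ⧸ J t) M n) (LC.trans hJ M n)

instance : AddCommGroup (LC hJ M n) :=
  inferInstanceAs (AddCommGroup (Module.DirectLimit _ (LC.trans hJ M n)))

instance : Module R (LC hJ M n) :=
  inferInstanceAs (Module R (Module.DirectLimit _ (LC.trans hJ M n)))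

namespace LC

instance : DirectedSystem (fun t ↦ ExtM R (R ⧸ J t) M n)
    (fun s t h ↦ LC.trans hJ M n s t h) where
  map_self t x := by
    unfold trans
    rw [Koszul.fac_refl]
    exact pre_id _ _
  map_map s t r h h' x := by
    unfold trans
    rw [pre_pre, Koszul.fac_comp]

/-- The map from a stage to the direct limit. -/
def of (t : ℕ) : ExtM R (R ⧸ J t) M n →ₗ[R] LC hJ M n :=
  Module.DirectLimit.of R ℕ _ (LC.trans hJ M n) t

variable {M n}

lemma of_pre {s t : ℕ} (h : s ≤ t) (e : ExtM R (R ⧸ J s) M n) :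
    of hJ M n t (pre (fac (hJ h)) n e) = of hJ M n s e :=
  Module.DirectLimit.of_f (f := LC.trans hJ M n) (hij := h)

lemma exists_of (z : LC hJ M n) : ∃ t e, of hJ M n t e = z :=
  Module.DirectLimit.exists_of (f := LC.trans hJ M n) z

lemma of_eq_zero {t : ℕ} {e : ExtM R (R ⧸ J t) M n} (h : of hJ M n t e = 0) :
    ∃ s, ∃ hs : t ≤ s, pre (fac (hJ hs)) n e = 0 :=
  Module.DirectLimit.of.zero_exact (f := LC.trans hJ M n) h

variable {P : Type*} [AddCommGroup P] [Module R P]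

/-- The universal property of the direct limit. -/
def lift (g : ∀ t, ExtM R (R ⧸ J t) M n →ₗ[R] P)
    (hg : ∀ s t (h : s ≤ t) e, g t (pre (fac (hJ h)) n e) = g s e) : LC hJ M n →ₗ[R] P :=
  Module.DirectLimit.lift R ℕ _ (LC.trans hJ M n) g hg

lemma lift_of (g : ∀ t, ExtM R (R ⧸ J t) M n →ₗ[R] P)
    (hg : ∀ s t (h : s ≤ t) e, g t (pre (fac (hJ h)) n e) = g s e) (t : ℕ)
    (e : ExtM R (R ⧸ J t) M n) : lift hJ g hg (of hJ M n t e) = g t e :=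
  Module.DirectLimit.lift_of (f := LC.trans hJ M n) _ _ _

lemma hom_ext {f g : LC hJ M n →ₗ[R] P} (h : ∀ t e, f (of hJ M n t e) = g (of hJ M n t e)) :
    f = g := by
  ext z
  obtain ⟨t, e, rfl⟩ := exists_of hJ z
  exact h t e

variable {J₂ : ℕ → Ideal R} (hJ₂ : Antitone J₂)

/-- The comparison map for two systems of ideals, the first finer than the second. -/
def compare (h : ∀ t, ∃ s, J₂ s ≤ J t) : LC hJ M n →ₗ[R] LC hJ₂ M n :=
  lift hJ (fun t ↦ of hJ₂ M n (h t).choose ∘ₗ pre (fac (h t).choose_spec) n) (by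
    intro s t hst e
    simp only [LinearMap.comp_apply, pre_pre, Koszul.fac_comp]
    rw [← of_pre hJ₂ (le_max_left (h t).choose (h s).choose), pre_pre, Koszul.fac_comp,
      ← of_pre hJ₂ (le_max_right (h t).choose (h s).choose), pre_pre, Koszul.fac_comp])

lemma compare_of (h : ∀ t, ∃ s, J₂ s ≤ J t) {s t : ℕ} (hst : J₂ s ≤ J t)
    (e : ExtM R (R ⧸ J t) M n) :
    compare hJ hJ₂ h (of hJ M n t e) = of hJ₂ M n s (pre (fac hst) n e) := by
  rw [compare, lift_of]
  simp only [LinearMap.comp_apply]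
  rw [← of_pre hJ₂ (le_max_left (h t).choose s), pre_pre, Koszul.fac_comp,
      ← of_pre hJ₂ (le_max_right (h t).choose s), pre_pre, Koszul.fac_comp]

variable (M n) in
/-- Cofinal systems of ideals give the same direct limit. -/
def equivOfCofinal (h : ∀ t, ∃ s, J₂ s ≤ J t) (h' : ∀ t, ∃ s, J s ≤ J₂ t) :
    LC hJ M n ≃ₗ[R] LC hJ₂ M n :=
  LinearEquiv.ofLinearMap (compare hJ hJ₂ h) (compare hJ₂ hJ h')
    (hom_ext _ fun t e ↦ by
      obtain ⟨s, hs⟩ := h' t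
      obtain ⟨r, hr⟩ := h s
      rw [LinearMap.comp_apply, compare_of hJ₂ hJ h' hs, compare_of hJ hJ₂ h
        ((hJ₂ (le_max_left r t)).trans hr : J₂ (max r t) ≤ _), pre_pre, Koszul.fac_comp]
      exact of_pre hJ₂ (le_max_right r t) e)
    (hom_ext _ fun t e ↦ by
      obtain ⟨s, hs⟩ := h t
      obtain ⟨r, hr⟩ := h' s
      rw [LinearMap.comp_apply, compare_of hJ hJ₂ h hs, compare_of hJ₂ hJ h'
        ((hJ (le_max_left r t)).trans hr : J (max r t) ≤ _), pre_pre, Koszul.fac_comp]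
      exact of_pre hJ (le_max_right r t) e)

lemma pow_antitone (I : Ideal R) : Antitone (fun t ↦ I ^ t) := fun _ _ h ↦ Ideal.pow_le_pow_right h

open Limits

/-- The map from a stage to local cohomology. -/
def toLocalCohomology (I : Ideal R) (n : ℕ) (M : ModuleCat.{u} R) (t : ℕ) :
    ((Ext R (ModuleCat.{u} R) n).obj (op (ModuleCat.of R (R ⧸ I ^ t)))).obj M ⟶
      (localCohomology I n).obj M :=
  (colimit.ι (localCohomology.diagram (localCohomology.idealPowersDiagram I) n) (op (op t))).app M

lemma toLocalCohomology_map (I : Ideal R) (n : ℕ) (M : ModuleCat.{u} R) {s t : ℕ} (h : s ≤ t) :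
    ((Ext R (ModuleCat.{u} R) n).map (ModuleCat.ofHom (fac (pow_antitone I h))).op).app M ≫
      toLocalCohomology I n M t = toLocalCohomology I n M s :=
  congrArg (fun f ↦ f.app M) (colimit.w
    (localCohomology.diagram (localCohomology.idealPowersDiagram I) n) (homOfLE h).op.op)

/-- The cocone with point the direct limit of `Ext` modules. -/
def cocone (I : Ideal R) (n : ℕ) (M : ModuleCat.{u} R) :
    Cocone (localCohomology.diagram (localCohomology.idealPowersDiagram I) n ⋙
      (evaluation _ _).obj M) where
  pt := ModuleCat.of R (LC (pow_antitone I) M n)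
  ι :=
  { app t := ModuleCat.ofHom (of (pow_antitone I) M n t.unop.unop ∘ₗ
      (ofDerived (ModuleCat.of R (R ⧸ I ^ t.unop.unop)) M n).toLinearMap)
    naturality s t f := by
      ext e
      have h := f.unop.unop.le
      have := congrArg (of (pow_antitone I) M n t.unop.unop)
        (ofDerived_naturality M n (fac (pow_antitone I h)) e)
      rw [of_pre (pow_antitone I) h] at this
      exact this }

/-- The map from local cohomology to a direct limit of `Ext` modules. -/
def ofLocalCohomology (I : Ideal R) (n : ℕ) (M : ModuleCat.{u} R) :
    (localCohomology I n).obj M →ₗ[R] LC (pow_antitone I) M n :=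
  ((colimitObjIsoColimitCompEvaluation _ M).hom ≫ colimit.desc _ (cocone I n M)).hom

lemma ofLocalCohomology_toLocalCohomology (I : Ideal R) (n : ℕ) (M : ModuleCat.{u} R) (t : ℕ)
    (e : ((Ext R (ModuleCat.{u} R) n).obj (op (ModuleCat.of R (R ⧸ I ^ t)))).obj M) :
    ofLocalCohomology I n M ((toLocalCohomology I n M t).hom e) =
      of (pow_antitone I) M n t (ofDerived (ModuleCat.of R (R ⧸ I ^ t)) M n e) := by
  have h1 := colimitObjIsoColimitCompEvaluation_ι_app_hom
    (localCohomology.diagram (localCohomology.idealPowersDiagram I) n) (op (op t)) M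
  have h2 := LinearMap.congr_fun (congrArg ModuleCat.Hom.hom h1) e
  refine (congrArg (colimit.desc _ (cocone I n M)).hom h2).trans ?_
  exact LinearMap.congr_fun (congrArg ModuleCat.Hom.hom
    (colimit.ι_desc (cocone I n M) (op (op t)))) e

lemma localCohomology_hom_ext (I : Ideal R) (n : ℕ) (M : ModuleCat.{u} R) {P : Type u}
    [AddCommGroup P] [Module R P] {f g : (localCohomology I n).obj M →ₗ[R] P}
    (h : ∀ t, f ∘ₗ (toLocalCohomology I n M t).hom = g ∘ₗ (toLocalCohomology I n M t).hom) :
    f = g := by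
  let F := localCohomology.diagram (localCohomology.idealPowersDiagram I) n
  have hc : IsColimit (((evaluation _ _).obj M).mapCocone (colimit.cocone F)) :=
    isColimitOfPreserves _ (colimit.isColimit F)
  have : ModuleCat.ofHom (Y := P) f = ModuleCat.ofHom (Y := P) g :=
    hc.hom_ext fun t ↦ ModuleCat.hom_ext (h t.unop.unop)
  exact congrArg ModuleCat.Hom.hom this

/-- Local cohomology as a direct limit of `Ext` modules. -/
def localCohomologyEquiv (I : Ideal R) (n : ℕ) (M : ModuleCat.{u} R) :
    (localCohomology I n).obj M ≃ₗ[R] LC (pow_antitone I) M n :=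
  LinearEquiv.ofLinearMap (ofLocalCohomology I n M)
    (lift _ (fun t ↦ (toLocalCohomology I n M t).hom ∘ₗ
      (ofDerived (ModuleCat.of R (R ⧸ I ^ t)) M n).symm.toLinearMap) (by
      intro s t h e
      obtain ⟨e, rfl⟩ := (ofDerived (ModuleCat.of R (R ⧸ I ^ s)) M n).surjective e
      rw [← ofDerived_naturality]
      simp only [LinearMap.comp_apply, LinearEquiv.coe_coe, LinearEquiv.symm_apply_apply]
      exact LinearMap.congr_fun (congrArg ModuleCat.Hom.hom (toLocalCohomology_map I n M h)) e))
    (hom_ext _ fun t e ↦ by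
      rw [LinearMap.comp_apply, lift_of]
      simp only [LinearMap.comp_apply, LinearEquiv.coe_coe]
      rw [ofLocalCohomology_toLocalCohomology]
      simp)
    (localCohomology_hom_ext I n M fun t ↦ by
      ext e
      simp only [LinearMap.comp_apply]
      rw [ofLocalCohomology_toLocalCohomology, lift_of]
      simp)

end LC
end LC

end

section

open ExtM

namespace LC

variable {R : Type u} [CommRing R] {J : ℕ → Ideal R} (hJ : Antitone J) {M M' M'' : Type u}
  [AddCommGroup M] [Module R M] [AddCommGroup M'] [Module R M'] [AddCommGroup M''] [Module R M'']
  (n : ℕ)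

/-- Functoriality of the direct limit. -/
def map (g : M →ₗ[R] M') : LC hJ M n →ₗ[R] LC hJ M' n :=
  lift hJ (fun t ↦ of hJ M' n t ∘ₗ post g n) fun s t h e ↦ by
    simp only [LinearMap.comp_apply]
    rw [← pre_post, of_pre hJ h]

lemma map_of (g : M →ₗ[R] M') (t : ℕ) (e : ExtM R (R ⧸ J t) M n) :
    map hJ n g (of hJ M n t e) = of hJ M' n t (post g n e) :=
  lift_of hJ _ _ t e

end LC

open IsLocalRing Koszul

/-- A system of parameters of a local ring all of whose powers are regular sequences. -/
structure RegularParameters (R : Type u) [CommRing R] [IsLocalRing R] where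
  /-- The number of parameters. -/
  d : ℕ
  /-- The parameters. -/
  x : ℕ → R
  reg : ∀ t, ∀ i < d, RegAt (fun i ↦ x i ^ t) R i
  mem : ∀ i, x i ∈ maximalIdeal R
  cofinal : ∀ t, ∃ n, maximalIdeal R ^ n ≤ K (fun i ↦ x i ^ t) d

namespace RegularParameters

variable {R : Type u} [CommRing R] [IsLocalRing R] (S : RegularParameters R)
  (M : Type u) {M' M'' : Type u} [AddCommGroup M'] [Module R M'] [AddCommGroup M'']
  [Module R M''] [AddCommGroup M] [Module R M]

/-- The ideal generated by the `t`-th powers of the parameters. -/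
def J (t : ℕ) : Ideal R := K (fun i ↦ S.x i ^ t) S.d

lemma pow_eq_mul {s t : ℕ} (h : s ≤ t) (i : ℕ) : S.x i ^ t = S.x i ^ (t - s) * S.x i ^ s := by
  rw [← pow_add]; congr 1; lia

lemma antitone : Antitone S.J := fun s t h ↦
  K_le_K (z := fun i ↦ S.x i ^ (t - s)) fun i _ ↦ S.pow_eq_mul h i

lemma J_le_pow (t : ℕ) : S.J t ≤ maximalIdeal R ^ t :=
  K_le fun i _ ↦ Ideal.pow_mem_pow (S.mem i) t

/-- The product of the parameters. -/
def X : R := ∏ i ∈ Finset.range S.d, S.x i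

/-- Local cohomology in degree `i`, with respect to the powers of the parameters. -/
abbrev LCoh (i : ℕ) : Type u := LC S.antitone M i

/-- The canonical map `M → Ext^d(R / J t, M)`. -/
def top (t : ℕ) : M →ₗ[R] ExtM R (R ⧸ S.J t) M S.d := kap M (fun i ↦ S.x i ^ t) S.d

lemma top_surjective (t : ℕ) : Function.Surjective (S.top M t) := kap_surjective _ S.d (S.reg t)

variable {M} in
lemma top_eq_zero_iff {t : ℕ} {m : M} :
    S.top M t m = 0 ↔ m ∈ S.J t • (⊤ : Submodule R M) := kap_eq_zero_iff _ S.d (S.reg t) m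

variable {M} in
lemma post_top (g : M →ₗ[R] M') (t : ℕ) (m : M) :
    post g S.d (S.top M t m) = S.top M' t (g m) := post_kap _ _ _ _

variable {M} in
lemma pre_top {s t : ℕ} (h : s ≤ t) (m : M) :
    pre (fac (S.antitone h)) S.d (S.top M s m) = S.top M t (S.X ^ (t - s) • m) := by
  rw [X, ← Finset.prod_pow]
  exact pre_kap (z := fun i ↦ S.x i ^ (t - s)) S.d (S.reg t) (S.reg s)
    (fun i _ ↦ S.pow_eq_mul h i) (S.antitone h) m

/-- The class of an element of `M` in top local cohomology. -/
def cl (t : ℕ) : M →ₗ[R] S.LCoh M S.d := LC.of S.antitone M S.d t ∘ₗ S.top M t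

variable {M}

lemma cl_apply (t : ℕ) (m : M) : S.cl M t m = LC.of S.antitone M S.d t (S.top M t m) := rfl

lemma cl_eq_cl {s t : ℕ} (h : s ≤ t) (m : M) : S.cl M s m = S.cl M t (S.X ^ (t - s) • m) := by
  rw [cl_apply, cl_apply, ← S.pre_top h, LC.of_pre S.antitone h]

lemma exists_cl (z : S.LCoh M S.d) : ∃ t m, S.cl M t m = z := by
  obtain ⟨t, e, rfl⟩ := LC.exists_of S.antitone z
  obtain ⟨m, rfl⟩ := S.top_surjective M t e
  exact ⟨t, m, rfl⟩

lemma cl_eq_zero_of_mem {t : ℕ} {m : M} (hm : m ∈ S.J t • (⊤ : Submodule R M)) :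
    S.cl M t m = 0 := by
  rw [cl_apply, S.top_eq_zero_iff.2 hm, map_zero]

lemma map_cl (g : M →ₗ[R] M') (t : ℕ) (m : M) :
    LC.map S.antitone S.d g (S.cl M t m) = S.cl M' t (g m) := by
  rw [cl_apply, LC.map_of, post_top, cl_apply]

lemma hom_ext_cl {P : Type*} [AddCommGroup P] [Module R P] {f g : S.LCoh M S.d →ₗ[R] P}
    (h : ∀ t m, f (S.cl M t m) = g (S.cl M t m)) : f = g := by
  ext z
  obtain ⟨t, m, rfl⟩ := S.exists_cl z
  exact h t m

variable (M) in
/-- The action map `M × H → LC(M)`, where `H` is the top local cohomology of the ring. -/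
def act : M →ₗ[R] S.LCoh R S.d →ₗ[R] S.LCoh M S.d where
  toFun m := LC.map S.antitone S.d (LinearMap.toSpanSingleton R M m)
  map_add' m m' := S.hom_ext_cl fun t r ↦ by
    rw [LinearMap.add_apply, map_cl, map_cl, map_cl, ← map_add]; simp
  map_smul' a m := S.hom_ext_cl fun t r ↦ by
    rw [LinearMap.smul_apply, map_cl, map_cl, RingHom.id_apply, ← map_smul,
      LinearMap.toSpanSingleton_apply, LinearMap.toSpanSingleton_apply, smul_comm]

lemma act_cl (m : M) (t : ℕ) (r : R) : S.act M m (S.cl R t r) = S.cl M t (r • m) := by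
  simp only [act, LinearMap.coe_mk, AddHom.coe_mk]
  rw [map_cl]; simp

lemma map_act (g : M →ₗ[R] M') (m : M) (h : S.LCoh R S.d) :
    LC.map S.antitone S.d g (S.act M m h) = S.act M' (g m) h := by
  obtain ⟨t, r, rfl⟩ := S.exists_cl h
  rw [act_cl, act_cl, map_cl, map_smul]

variable {E : Type u} [AddCommGroup E] [Module R E]

variable (M E) in
/-- The adjunction map `Hom(LC(M), E) → Hom(M, Hom(H, E))`. -/
def adj : (S.LCoh M S.d →ₗ[R] E) →ₗ[R] M →ₗ[R] S.LCoh R S.d →ₗ[R] E where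
  toFun f := LinearMap.llcomp R _ _ _ f ∘ₗ S.act M
  map_add' f g := by ext; simp
  map_smul' a f := by ext; simp

lemma adj_apply (f : S.LCoh M S.d →ₗ[R] E) (m : M) (h : S.LCoh R S.d) :
    S.adj M E f m h = f (S.act M m h) := rfl

lemma adj_injective : Function.Injective (S.adj M E) := by
  intro f g h
  refine S.hom_ext_cl fun t m ↦ ?_
  have := LinearMap.congr_fun (LinearMap.congr_fun h m) (S.cl R t 1)
  rwa [adj_apply, adj_apply, act_cl, one_smul] at this

end RegularParameters

end

section

open IsLocalRing Koszul ExtM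

lemma Ideal.quotient_hom_ext {R N : Type*} [CommRing R] [AddCommGroup N] [Module R N]
    {I : Ideal R} {f g : (R ⧸ I) →ₗ[R] N} (h : f (I.mkQ 1) = g (I.mkQ 1)) : f = g :=
  Submodule.linearMap_qext _ (LinearMap.ext_ring h)

lemma LinearMap.exists_comp_eq_of_ker_le {R A B C : Type*} [Ring R] [AddCommGroup A] [Module R A]
    [AddCommGroup B] [Module R B] [AddCommGroup C] [Module R C] {p : A →ₗ[R] B}
    (hp : Function.Surjective p) {g : A →ₗ[R] C} (h : ker p ≤ ker g) :
    ∃ φ : B →ₗ[R] C, φ ∘ₗ p = g := by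
  refine ⟨(ker p).liftQ g h ∘ₗ (p.quotKerEquivOfSurjective hp).symm.toLinearMap, ?_⟩
  ext a
  have : (p.quotKerEquivOfSurjective hp).symm (p a) = (ker p).mkQ a := by
    rw [LinearEquiv.symm_apply_eq]; rfl
  simp [this]

/-- Two injective hulls of a module are isomorphic. -/
lemma Module.Injective.nonempty_equiv_of_essential {R : Type u} [CommRing R] {k E E' : Type u}
    [AddCommGroup k] [Module R k] [AddCommGroup E] [Module R E] [AddCommGroup E'] [Module R E']
    [Module.Injective R E] [Module.Injective R E'] (ι : k →ₗ[R] E) (ι' : k →ₗ[R] E')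
    (hι : Function.Injective ι) (hι' : Function.Injective ι')
    (h : ∀ N : Submodule R E, N ≠ ⊥ → N ⊓ LinearMap.range ι ≠ ⊥)
    (h' : ∀ N : Submodule R E', N ≠ ⊥ → N ⊓ LinearMap.range ι' ≠ ⊥) : Nonempty (E ≃ₗ[R] E') := by
  obtain ⟨f, hf⟩ := Module.Injective.out ι' hι' ι
  have hfi : Function.Injective f := by
    rw [← LinearMap.ker_eq_bot]
    by_contra hk
    refine h' _ hk ((Submodule.eq_bot_iff _).2 ?_)
    rintro _ ⟨hx, a, rfl⟩
    rw [SetLike.mem_coe, LinearMap.mem_ker, hf, map_eq_zero_iff _ hι] at hx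
    simp [hx]
  obtain ⟨r, hr⟩ := Module.Injective.out f hfi LinearMap.id
  have hri : Function.Injective r := by
    rw [← LinearMap.ker_eq_bot]
    by_contra hk
    refine h _ hk ((Submodule.eq_bot_iff _).2 ?_)
    rintro _ ⟨hx, a, rfl⟩
    rw [SetLike.mem_coe, LinearMap.mem_ker, ← hf, hr] at hx
    rw [LinearMap.id_apply, map_eq_zero_iff _ hι'] at hx
    simp [hx]
  exact ⟨LinearEquiv.ofBijective r ⟨hri, fun x ↦ ⟨f x, hr x⟩⟩⟩

lemma ExtM.SES.ext_subsingleton {R : Type u} [CommRing R] {A B C M : Type u}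
    [AddCommGroup A] [Module R A] [AddCommGroup B]
    [Module R B] [AddCommGroup C] [Module R C] [AddCommGroup M] [Module R M] (E : SES R A B C)
    (n : ℕ) (hA : Subsingleton (ExtM R A M n)) (hC : Subsingleton (ExtM R C M n)) :
    Subsingleton (ExtM R B M n) := by
  refine subsingleton_of_forall_eq 0 fun e ↦ ?_
  obtain ⟨v, rfl⟩ := (E.exact_pre₂ n e).1 (Subsingleton.elim _ _)
  rw [Subsingleton.elim v 0, map_zero]

namespace RegularParameters

variable {R : Type u} [CommRing R] [IsLocalRing R] (S : RegularParameters R)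

/-- The module `N` is annihilated by the `t`-th powers of the parameters. -/
def Killed (t : ℕ) (N : Type u) [AddCommGroup N] [Module R N] : Prop :=
  ∀ a ∈ S.J t, ∀ x : N, a • x = 0

variable {S} {N N' : Type u} [AddCommGroup N] [Module R N] [AddCommGroup N'] [Module R N']

lemma Killed.mono {s t : ℕ} (h : S.Killed s N) (hst : s ≤ t) : S.Killed t N :=
  fun a ha x ↦ h a (S.antitone hst ha) x

lemma Killed.of_injective {t : ℕ} (h : S.Killed t N') (f : N →ₗ[R] N') (hf : Function.Injective f) :
    S.Killed t N :=
  fun a ha x ↦ hf (by rw [map_smul, h a ha, map_zero])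

lemma Killed.of_surjective {t : ℕ} (h : S.Killed t N) (f : N →ₗ[R] N')
    (hf : Function.Surjective f) : S.Killed t N' := by
  intro a ha x
  obtain ⟨y, rfl⟩ := hf x
  rw [← map_smul, h a ha, map_zero]

lemma killed_quotient {t : ℕ} {I : Ideal R} (h : S.J t ≤ I) : S.Killed t (R ⧸ I) := by
  intro a ha x
  obtain ⟨y, rfl⟩ := Submodule.mkQ_surjective I x
  rw [← map_smul, smul_eq_mul, mul_comm]
  exact (Submodule.Quotient.mk_eq_zero _).2 (I.mul_mem_left y (h ha))

lemma Killed.le_of_quotient {t : ℕ} {I : Ideal R} (h : S.Killed t (R ⧸ I)) : S.J t ≤ I := by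
  intro a ha
  have := h a ha (I.mkQ 1)
  rw [← map_smul, smul_eq_mul, mul_one] at this
  exact (Submodule.Quotient.mk_eq_zero _).1 this

lemma le_maximalIdeal_succ (t : ℕ) : S.J (t + 1) ≤ maximalIdeal R :=
  (S.J_le_pow _).trans (Ideal.pow_le_self (Nat.succ_ne_zero t))

lemma Killed.eq_maximalIdeal {t : ℕ} {p : Ideal R} [hp : p.IsPrime] (h : S.Killed t (R ⧸ p)) :
    p = maximalIdeal R := by
  obtain ⟨n, hn⟩ := S.cofinal t
  have : maximalIdeal R ^ n ≤ p := le_trans hn h.le_of_quotient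
  exact ((IsLocalRing.maximalIdeal.isMaximal R).eq_of_le hp.ne_top (hp.le_of_pow_le this)).symm

/-- Induction for finitely generated modules supported at the maximal ideal. -/
lemma Killed.induction [IsNoetherianRing R] {t : ℕ}
    {P : (N : Type u) → [AddCommGroup N] → [Module R N] → Prop}
    (zero : ∀ (N : Type u) [AddCommGroup N] [Module R N] [Subsingleton N], P N)
    (field : ∀ (N : Type u) [AddCommGroup N] [Module R N], (N ≃ₗ[R] R ⧸ maximalIdeal R) → P N)
    (ses : ∀ (A B C : Type u) [AddCommGroup A] [Module R A] [AddCommGroup B] [Module R B]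
      [AddCommGroup C] [Module R C] [Module.Finite R A] [Module.Finite R B] [Module.Finite R C],
      SES R A B C → S.Killed t A → S.Killed t B → S.Killed t C → P A → P C → P B)
    [hN : Module.Finite R N] (h : S.Killed t N) : P N := by
  revert h
  induction hN using IsNoetherianRing.induction_on_isQuotientEquivQuotientPrime R with
  | subsingleton N => exact fun _ ↦ zero N
  | quotient N p f =>
    intro h
    have := (h.of_surjective f.toLinearMap f.surjective).eq_maximalIdeal
    exact field N (f.trans (Submodule.quotEquivOfEq _ _ this))
  | exact A B C f g hf hg hfg hA hC =>
    intro h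
    exact ses A B C ⟨f, g, hf, hfg, hg⟩ (h.of_injective f hf) h (h.of_surjective g hg)
      (hA (h.of_injective f hf)) (hC (h.of_surjective g hg))

variable (S) in
/-- The characterization of canonical modules by the Yoneda `Ext` of the residue field. -/
structure IsCanonical (ω : Type u) [AddCommGroup ω] [Module R ω] : Prop where
  subsingleton : ∀ i ≠ S.d, Subsingleton (ExtM R (R ⧸ maximalIdeal R) ω i)
  top : Nonempty (ExtM R (R ⧸ maximalIdeal R) ω S.d ≃ₗ[R] R ⧸ maximalIdeal R)

variable {ω : Type u} [AddCommGroup ω] [Module R ω]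

/-- The map `R / J t → N` sending `1` to `n`. -/
def elt {t : ℕ} (h : S.Killed t N) (n : N) : (R ⧸ S.J t) →ₗ[R] N :=
  (S.J t).liftQ (LinearMap.toSpanSingleton R N n) fun a ha ↦ h a ha n

lemma elt_mk {t : ℕ} (h : S.Killed t N) (n : N) (r : R) : elt h n ((S.J t).mkQ r) = r • n := rfl

@[simp] lemma elt_one {t : ℕ} (h : S.Killed t N) (n : N) : elt h n ((S.J t).mkQ 1) = n :=
  one_smul R n

variable (ω) in
/-- The duality pairing of `Ext^d(N, ω)` and `N`. -/
def psi {t : ℕ} (h : S.Killed t N) : ExtM R N ω S.d →ₗ[R] N →ₗ[R] S.LCoh ω S.d :=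
  LinearMap.mk₂ R (fun e n ↦ LC.of S.antitone ω S.d t (pre (elt h n) S.d e))
    (by intro e e' n; rw [map_add, map_add]) (by intro a e n; rw [map_smul, map_smul])
    (by
      intro e n n'
      have : elt h (n + n') = elt h n + elt h n' := by
        apply Ideal.quotient_hom_ext; simp only [LinearMap.add_apply, elt_one]
      rw [this, pre_add, map_add])
    (by
      intro a e n
      have : elt h (a • n) = a • elt h n := by
        apply Ideal.quotient_hom_ext; simp only [LinearMap.smul_apply, elt_one]
      rw [this, pre_smul, map_smul])

lemma psi_apply {t : ℕ} (h : S.Killed t N) (e : ExtM R N ω S.d) (n : N) :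
    psi ω h e n = LC.of S.antitone ω S.d t (pre (elt h n) S.d e) := rfl

lemma psi_pre {t : ℕ} (h : S.Killed t N) (h' : S.Killed t N') (f : N →ₗ[R] N')
    (e : ExtM R N' ω S.d) : psi ω h (pre f S.d e) = psi ω h' e ∘ₗ f := by
  ext n
  have : f ∘ₗ elt h n = elt h' (f n) := by
    apply Ideal.quotient_hom_ext; rw [LinearMap.comp_apply, elt_one, elt_one]
  rw [psi_apply, pre_pre, LinearMap.comp_apply, psi_apply, this]

lemma psi_quotient_mk {t : ℕ} (h : S.Killed t (R ⧸ S.J t)) (e : ExtM R (R ⧸ S.J t) ω S.d) (r : R) :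
    psi ω h e ((S.J t).mkQ r) = r • LC.of S.antitone ω S.d t e := by
  have : elt h ((S.J t).mkQ r) = r • LinearMap.id := by
    apply Ideal.quotient_hom_ext
    rw [elt_one, LinearMap.smul_apply, LinearMap.id_apply, ← map_smul, smul_eq_mul, mul_one]
  rw [psi_apply, this, ← smul_eq_pre, map_smul]

lemma exists_rep (t : ℕ) (z : S.LCoh ω S.d) :
    ∃ s, t ≤ s ∧ ∃ e, LC.of S.antitone ω S.d s e = z := by
  obtain ⟨s, e, rfl⟩ := LC.exists_of S.antitone z
  exact ⟨max s t, le_max_right _ _, _, LC.of_pre S.antitone (le_max_left s t) e⟩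

lemma psi_of_le {s t : ℕ} (hst : s ≤ t) (h : S.Killed s N) (e : ExtM R N ω S.d) :
    psi ω (h.mono hst) e = psi ω h e := by
  ext n
  have : elt (h.mono hst) n = elt h n ∘ₗ fac (S.antitone hst) := by
    apply Ideal.quotient_hom_ext; exact (elt_one _ n).trans (elt_one h n).symm
  rw [psi_apply, psi_apply, this, ← pre_pre, LC.of_pre S.antitone hst]

variable [IsNoetherianRing R]

lemma IsCanonical.ext_subsingleton (hω : S.IsCanonical ω) {t : ℕ} [Module.Finite R N]
    (h : S.Killed t N) (i : ℕ) (hi : i ≠ S.d) : Subsingleton (ExtM R N ω i) := by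
  refine h.induction (P := fun N _ _ ↦ Subsingleton (ExtM R N ω i)) ?_ ?_ ?_
  · intro N _ _ _
    refine subsingleton_of_forall_eq 0 fun e ↦ ?_
    rw [← pre_id i e, Subsingleton.elim (LinearMap.id : N →ₗ[R] N) 0, pre_zero]
  · intro N _ _ f
    have := hω.subsingleton i hi
    exact (preEquiv f i).symm.injective.subsingleton
  · intro A B C _ _ _ _ _ _ _ _ _ E _ _ _ hA hC
    exact E.ext_subsingleton i hA hC

/-- The short exact sequence of a surjection. -/
def _root_.ExtM.SES.ofSurjective {A B : Type u} [AddCommGroup A] [Module R A] [AddCommGroup B]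
    [Module R B] (g : A →ₗ[R] B) (hg : Function.Surjective g) : SES R (LinearMap.ker g) A B :=
  ⟨(LinearMap.ker g).subtype, g, Submodule.injective_subtype _,
    LinearMap.exact_subtype_ker_map g, hg⟩

/-- The short exact sequence of an injection. -/
def _root_.ExtM.SES.ofInjective {A B : Type u} [AddCommGroup A] [Module R A] [AddCommGroup B]
    [Module R B] (f : A →ₗ[R] B) (hf : Function.Injective f) :
    SES R A B (B ⧸ LinearMap.range f) :=
  ⟨f, (LinearMap.range f).mkQ, hf, LinearMap.exact_map_mkQ_range f, Submodule.mkQ_surjective _⟩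

lemma IsCanonical.pre_injective (hω : S.IsCanonical ω) {t : ℕ} [Module.Finite R N]
    (h : S.Killed t N) (g : N →ₗ[R] N') (hg : Function.Surjective g) :
    Function.Injective (pre (M := ω) g S.d) := by
  let E := SES.ofSurjective g hg
  obtain hd | ⟨n, hn⟩ : S.d = 0 ∨ ∃ n, S.d = n + 1 := by cases S.d <;> simp
  · rw [hd]; exact E.pre_zero_injective
  · have := hω.ext_subsingleton (h.of_injective E.f E.inj) n (by lia)
    have hinj : Function.Injective (pre (M := ω) E.g (n + 1)) := by
      rw [injective_iff_map_eq_zero]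
      intro e he
      obtain ⟨v, rfl⟩ := (E.exact_pre₃ n e).1 he
      rw [Subsingleton.elim v 0, map_zero]
    rw [hn]; exact hinj

lemma IsCanonical.pre_surjective (hω : S.IsCanonical ω) {t : ℕ} [Module.Finite R N']
    (h : S.Killed t N') (f : N →ₗ[R] N') (hf : Function.Injective f) :
    Function.Surjective (pre (M := ω) f S.d) := by
  intro e
  let E := SES.ofInjective f hf
  have := hω.ext_subsingleton (h.of_surjective E.g E.surj) (S.d + 1) (by lia)
  exact (E.exact_pre₁ S.d e).1 (Subsingleton.elim _ _)

lemma IsCanonical.of_injective (hω : S.IsCanonical ω) (t : ℕ) :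
    Function.Injective (LC.of S.antitone ω S.d t) := by
  rw [injective_iff_map_eq_zero]
  intro e he
  obtain ⟨s, hs, h⟩ := LC.of_eq_zero S.antitone he
  exact (map_eq_zero_iff _ (hω.pre_injective (killed_quotient (le_refl (S.J s)))
    (fac (S.antitone hs)) (Submodule.factor_surjective (S.antitone hs)))).1 h

lemma IsCanonical.psi_injective (hω : S.IsCanonical ω) {t : ℕ} [Module.Finite R N]
    (h : S.Killed t N) : Function.Injective (psi ω h) := by
  refine h.induction (P := fun N _ _ ↦ ∀ h : S.Killed t N, Function.Injective (psi ω h))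
    ?_ ?_ ?_ h
  · intro N _ _ _ h e e' _
    rw [← pre_id S.d e, Subsingleton.elim (LinearMap.id : N →ₗ[R] N) 0, pre_zero,
      ← pre_id S.d e', Subsingleton.elim (LinearMap.id : N →ₗ[R] N) 0, pre_zero]
  · intro N _ _ f h
    rw [injective_iff_map_eq_zero]
    intro e he
    have hs : Function.Surjective (elt h (f.symm (Submodule.mkQ _ 1))) := by
      intro x
      obtain ⟨r, hr⟩ := Submodule.mkQ_surjective _ (f x)
      refine ⟨(S.J t).mkQ r, f.injective ?_⟩
      rw [elt_mk, map_smul, LinearEquiv.apply_symm_apply, ← hr, ← map_smul, smul_eq_mul, mul_one]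
    refine (map_eq_zero_iff _ (hω.pre_injective (killed_quotient (le_refl (S.J t))) _ hs)).1
      ((map_eq_zero_iff _ (hω.of_injective t)).1 ?_)
    rw [← psi_apply, he]; rfl
  · intro A B C _ _ _ _ _ _ _ _ _ E hA' hB' hC' hA hC h
    rw [injective_iff_map_eq_zero]
    intro e he
    have h1 : pre E.f S.d e = 0 := hA hA' (by
      rw [psi_pre hA' h, he, map_zero, LinearMap.zero_comp])
    obtain ⟨v, rfl⟩ := (E.exact_pre₂ S.d e).1 h1
    have h2 : v = 0 := hC hC' (by
      rw [psi_pre h hC'] at he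
      rw [map_zero]
      exact LinearMap.cancel_right E.surj |>.1 (by rw [he, LinearMap.zero_comp]))
    rw [h2, map_zero]

lemma IsCanonical.psi_quotient_surjective (hω : S.IsCanonical ω) {t : ℕ} {I : Ideal R}
    (h : S.Killed t (R ⧸ I)) : Function.Surjective (psi ω h) := by
  intro φ
  obtain ⟨s, hs, e, he⟩ := exists_rep t (φ (I.mkQ 1))
  have hI := (h.mono hs).le_of_quotient
  let p : (R ⧸ S.J s) →ₗ[R] (R ⧸ I) := fac hI
  have hk : S.Killed s (R ⧸ S.J s) := killed_quotient le_rfl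
  have h1 : psi ω hk e = φ ∘ₗ p := by
    apply Submodule.linearMap_qext
    ext
    refine (psi_quotient_mk hk e 1).trans ?_
    rw [one_smul, he]; rfl
  let E := SES.ofSurjective p (Submodule.factor_surjective hI)
  have hE := hk.of_injective E.f E.inj
  have h2 : pre E.f S.d e = 0 := hω.psi_injective hE (by
    rw [psi_pre hE hk, h1, map_zero, LinearMap.comp_assoc]
    have : p ∘ₗ E.f = 0 := E.exact.linearMap_comp_eq_zero
    rw [this, LinearMap.comp_zero])
  obtain ⟨v, rfl⟩ := (E.exact_pre₂ S.d e).1 h2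
  refine ⟨v, ?_⟩
  rw [← psi_of_le hs h]
  refine (LinearMap.cancel_right E.surj).1 ?_
  exact (psi_pre hk (h.mono hs) E.g v).symm.trans h1

lemma IsCanonical.psi_surjective (hω : S.IsCanonical ω) {t : ℕ} [Module.Finite R N]
    (h : S.Killed t N) : Function.Surjective (psi ω h) := by
  refine h.induction (P := fun N _ _ ↦ ∀ h : S.Killed t N, Function.Surjective (psi ω h))
    ?_ ?_ ?_ h
  · exact fun N _ _ _ h φ ↦ ⟨0, Subsingleton.elim _ _⟩
  · intro N _ _ f h φ
    have h' := h.of_surjective f.toLinearMap f.surjective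
    obtain ⟨e, he⟩ := hω.psi_quotient_surjective h' (φ ∘ₗ f.symm.toLinearMap)
    refine ⟨pre f.toLinearMap S.d e, ?_⟩
    rw [psi_pre h h', he]
    ext; simp
  · intro A B C _ _ _ _ _ _ _ _ _ E hA' hB' hC' hA hC h φ
    obtain ⟨u₁, hu₁⟩ := hA hA' (φ ∘ₗ E.f)
    obtain ⟨u₂, rfl⟩ := hω.pre_surjective h E.f E.inj u₁
    obtain ⟨φ', hφ'⟩ := LinearMap.exists_comp_eq_of_ker_le E.surj (g := φ - psi ω h u₂) (by
      intro x hx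
      obtain ⟨a, rfl⟩ := (E.exact x).1 hx
      rw [psi_pre hA' h] at hu₁
      rw [LinearMap.mem_ker, LinearMap.sub_apply, sub_eq_zero]
      exact (LinearMap.congr_fun hu₁ a).symm)
    obtain ⟨u₃, rfl⟩ := hC hC' φ'
    refine ⟨u₂ + pre E.g S.d u₃, ?_⟩
    rw [map_add, psi_pre h hC', hφ', add_sub_cancel]

end RegularParameters

end

section

open IsLocalRing Koszul ExtM

lemma IsPrecomplete.of_finite {R : Type u} [CommRing R] (I : Ideal R) (M : Type u)
    [AddCommGroup M] [Module R M] [Module.Finite R M] [IsPrecomplete I R] : IsPrecomplete I M := by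
  refine AdicCompletion.of_surjective_iff.1 fun z ↦ ?_
  obtain ⟨t, rfl⟩ := AdicCompletion.ofTensorProduct_surjective_of_finite I M z
  induction t using TensorProduct.induction_on with
  | zero => exact ⟨0, by simp⟩
  | tmul r x =>
    obtain ⟨r, rfl⟩ := AdicCompletion.of_surjective I R r
    refine ⟨r • x, ?_⟩
    rw [AdicCompletion.ofTensorProduct_tmul]
    ext n
    rw [map_smul]
    exact (algebraMap_smul (AdicCompletion I R) r (AdicCompletion.of I M x)).symm ▸ rfl
  | add a b ha hb =>
    obtain ⟨x, hx⟩ := ha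
    obtain ⟨y, hy⟩ := hb
    exact ⟨x + y, by rw [map_add, map_add, hx, hy]⟩

namespace RegularParameters

variable {R : Type u} [CommRing R] [IsLocalRing R] {S : RegularParameters R}
  {ω : Type u} [AddCommGroup ω] [Module R ω]

lemma exists_smul_eq_zero (z : S.LCoh ω S.d) : ∃ t, ∀ a ∈ S.J t, a • z = 0 := by
  obtain ⟨t, m, rfl⟩ := S.exists_cl z
  refine ⟨t, fun a ha ↦ ?_⟩
  rw [← map_smul]
  exact S.cl_eq_zero_of_mem (Submodule.smul_mem_smul ha trivial)

lemma exists_smul_map_eq_zero {N : Type u} [AddCommGroup N] [Module R N] [hN : Module.Finite R N]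
    (g : N →ₗ[R] S.LCoh ω S.d) : ∃ t, ∀ a ∈ S.J t, ∀ x, a • g x = 0 := by
  obtain ⟨s, hs⟩ := hN.fg_top
  choose t ht using fun x ↦ exists_smul_eq_zero (g x)
  refine ⟨s.sup t, fun a ha x ↦ ?_⟩
  have hx : x ∈ Submodule.span R (s : Set N) := hs ▸ trivial
  induction hx using Submodule.span_induction with
  | mem x hx => exact ht x a (S.antitone (Finset.le_sup hx) ha)
  | zero => simp
  | add x y _ _ hx hy => rw [map_add, smul_add, hx, hy, add_zero]
  | smul r x _ hx => rw [map_smul, smul_comm, hx, smul_zero]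

lemma exists_socle (z : S.LCoh ω S.d) (hz : z ≠ 0) :
    ∃ r : R, r • z ≠ 0 ∧ ∀ a ∈ maximalIdeal R, a • r • z = 0 := by
  have hex : ∃ n, ∀ a ∈ maximalIdeal R ^ n, a • z = 0 := by
    obtain ⟨t, ht⟩ := exists_smul_eq_zero z
    obtain ⟨n, hn⟩ := S.cofinal t
    exact ⟨n, fun a ha ↦ ht a (hn ha)⟩
  classical
  obtain ⟨n, hn⟩ : ∃ n, Nat.find hex = n + 1 := by
    refine Nat.exists_eq_succ_of_ne_zero fun h ↦ hz ?_
    have := Nat.find_spec hex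
    rw [h] at this
    simpa using this 1 (by simp)
  have h1 := Nat.find_min hex (m := n) (by lia)
  push Not at h1
  obtain ⟨r, hr, hrz⟩ := h1
  refine ⟨r, hrz, fun a ha ↦ ?_⟩
  have := Nat.find_spec hex
  rw [hn] at this
  rw [smul_smul]
  exact this _ (by rw [pow_succ']; exact Ideal.mul_mem_mul ha hr)

variable [IsNoetherianRing R]

lemma IsCanonical.baer (hω : S.IsCanonical ω) : Module.Baer R (S.LCoh ω S.d) := by
  intro I g
  obtain ⟨t, ht⟩ := exists_smul_map_eq_zero g
  obtain ⟨m, hm⟩ := S.cofinal t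
  obtain ⟨k, hk⟩ := Ideal.exists_pow_inf_eq_pow_smul (maximalIdeal R) (I : Submodule R R)
  let n := m + k
  have hn : ∀ x (hx : x ∈ I), x ∈ S.J n → g ⟨x, hx⟩ = 0 := by
    intro x hx hxn
    have hle : maximalIdeal R ^ m • ((maximalIdeal R ^ k • (⊤ : Submodule R R)) ⊓ I) ≤
        Submodule.map I.subtype (LinearMap.ker g) := by
      refine Submodule.smul_le.2 fun a ha b hb ↦ ?_
      refine ⟨a • ⟨b, hb.2⟩, ?_, rfl⟩
      rw [SetLike.mem_coe, LinearMap.mem_ker, map_smul]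
      exact ht a (hm ha) _
    have h1 : x ∈ maximalIdeal R ^ n • (⊤ : Submodule R R) ⊓ I := by
      refine ⟨?_, hx⟩
      simpa using S.J_le_pow n hxn
    rw [hk n (by lia), show n - k = m by lia] at h1
    obtain ⟨y, hy, rfl⟩ := hle h1
    exact hy
  let N : Submodule R (R ⧸ S.J n) := Submodule.map (S.J n).mkQ I
  let p : I →ₗ[R] N := (S.J n).mkQ.restrict fun x hx ↦ ⟨x, hx, rfl⟩
  have hp : Function.Surjective p := by
    rintro ⟨_, x, hx, rfl⟩
    exact ⟨⟨x, hx⟩, rfl⟩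
  obtain ⟨φ, hφ⟩ := LinearMap.exists_comp_eq_of_ker_le hp (g := g) (by
    rintro ⟨x, hx⟩ h
    refine hn x hx ((Submodule.Quotient.mk_eq_zero _).1 ?_)
    exact congrArg Subtype.val h)
  have hR : S.Killed n (R ⧸ S.J n) := killed_quotient le_rfl
  have hN := hR.of_injective N.subtype N.subtype_injective
  obtain ⟨u, rfl⟩ := hω.psi_surjective hN φ
  obtain ⟨v, rfl⟩ := hω.pre_surjective hR N.subtype N.subtype_injective u
  refine ⟨psi ω hR v ∘ₗ (S.J n).mkQ, fun x hx ↦ ?_⟩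
  rw [psi_pre hN hR] at hφ
  exact LinearMap.congr_fun hφ ⟨x, hx⟩

lemma IsCanonical.injective (hω : S.IsCanonical ω) : Module.Injective R (S.LCoh ω S.d) :=
  hω.baer.injective

lemma IsCanonical.exists_hull (hω : S.IsCanonical ω) :
    ∃ ι : (R ⧸ maximalIdeal R) →ₗ[R] S.LCoh ω S.d, Function.Injective ι ∧
      ∀ N : Submodule R (S.LCoh ω S.d), N ≠ ⊥ → N ⊓ LinearMap.range ι ≠ ⊥ := by
  obtain ⟨e⟩ := hω.top
  have hk : S.Killed 1 (R ⧸ maximalIdeal R) := killed_quotient (le_maximalIdeal_succ 0)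
  let u := e.symm (Submodule.mkQ _ 1)
  have hu (v) : ∃ r : R, r • u = v := by
    obtain ⟨r, hr⟩ := Submodule.mkQ_surjective _ (e v)
    refine ⟨r, ?_⟩
    rw [← map_smul, ← map_smul, smul_eq_mul, mul_one, hr, LinearEquiv.symm_apply_apply]
  refine ⟨psi ω hk u, ?_, fun N hN hbot ↦ ?_⟩
  · rw [injective_iff_map_eq_zero]
    intro x hx
    by_contra hx0
    obtain ⟨r, rfl⟩ := Submodule.mkQ_surjective _ x
    have hr : IsUnit r := by
      by_contra h
      exact hx0 ((Submodule.Quotient.mk_eq_zero _).2 h)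
    have h1 : psi ω hk u (Submodule.mkQ _ 1) = 0 := by
      rw [← hr.smul_eq_zero, ← map_smul, ← map_smul, smul_eq_mul, mul_one, hx]
    have h2 : psi ω hk u = 0 := Ideal.quotient_hom_ext h1
    have h3 : u = 0 := hω.psi_injective hk (by rw [h2, map_zero])
    rw [LinearEquiv.map_eq_zero_iff] at h3
    exact (IsLocalRing.maximalIdeal.isMaximal R).ne_top
      ((Ideal.eq_top_iff_one _).2 ((Submodule.Quotient.mk_eq_zero _).1 h3))
  · obtain ⟨z, hz, hz0⟩ := Submodule.exists_mem_ne_zero_of_ne_bot hN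
    obtain ⟨r, hr, hm⟩ := exists_socle z hz0
    let φ : (R ⧸ maximalIdeal R) →ₗ[R] S.LCoh ω S.d :=
      (maximalIdeal R).liftQ (LinearMap.toSpanSingleton R _ (r • z)) fun a ha ↦ hm a ha
    have hφ : φ (Submodule.mkQ _ 1) = r • z := one_smul R _
    obtain ⟨v, hv⟩ := hω.psi_surjective hk φ
    obtain ⟨s, rfl⟩ := hu v
    refine hr ((Submodule.eq_bot_iff _).1 hbot (r • z) ⟨N.smul_mem r hz, ?_⟩)
    refine ⟨s • Submodule.mkQ _ 1, ?_⟩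
    rw [map_smul, ← LinearMap.smul_apply, ← map_smul, hv, hφ]

section act

lemma IsCanonical.act_injective (hω : S.IsCanonical ω) [Module.Finite R ω] :
    Function.Injective (S.act ω) := by
  rw [injective_iff_map_eq_zero]
  intro w hw
  have h (t : ℕ) : w ∈ S.J t • (⊤ : Submodule R ω) := by
    rw [← S.top_eq_zero_iff, ← map_eq_zero_iff _ (hω.of_injective t), ← cl_apply,
      ← one_smul R w, ← act_cl, hw, LinearMap.zero_apply]
  have := Ideal.iInf_pow_smul_eq_bot_of_isLocalRing (M := ω) (maximalIdeal R)
    (IsLocalRing.maximalIdeal.isMaximal R).ne_top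
  rw [← Submodule.mem_bot R, ← this, Submodule.mem_iInf]
  exact fun t ↦ Submodule.smul_mono_left (S.J_le_pow t) (h t)

lemma IsCanonical.exists_cl_eq (hω : S.IsCanonical ω) (g : S.LCoh R S.d →ₗ[R] S.LCoh ω S.d)
    (t : ℕ) : ∃ w : ω, g (S.cl R t 1) = S.cl ω t w := by
  have hk : S.Killed t (R ⧸ S.J t) := killed_quotient le_rfl
  let φ : (R ⧸ S.J t) →ₗ[R] S.LCoh ω S.d :=
    (S.J t).liftQ (LinearMap.toSpanSingleton R _ (g (S.cl R t 1))) fun a ha ↦ by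
      rw [LinearMap.mem_ker, LinearMap.toSpanSingleton_apply, ← map_smul, ← map_smul,
        smul_eq_mul, mul_one, S.cl_eq_zero_of_mem (by simpa using ha), map_zero]
  have hφ : φ (Submodule.mkQ _ 1) = g (S.cl R t 1) := one_smul R _
  obtain ⟨e, he⟩ := hω.psi_surjective hk φ
  obtain ⟨w, rfl⟩ := S.top_surjective ω t e
  exact ⟨w, by rw [← hφ, ← he, psi_quotient_mk, one_smul, cl_apply]⟩

lemma IsCanonical.act_surjective (hω : S.IsCanonical ω) [Module.Finite R ω]
    [IsPrecomplete (maximalIdeal R) R] : Function.Surjective (S.act ω) := by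
  intro g
  choose w hw using hω.exists_cl_eq g
  have hJ {s t : ℕ} (h : s ≤ t) : w s - w t ∈ S.J s • (⊤ : Submodule R ω) := by
    rw [← S.top_eq_zero_iff, ← map_eq_zero_iff _ (hω.of_injective s), ← cl_apply, map_sub,
      sub_eq_zero, ← hw, S.cl_eq_cl h, S.cl_eq_cl h, map_smul, map_smul, map_smul, hw]
  have := IsPrecomplete.of_finite (maximalIdeal R) ω
  obtain ⟨L, hL⟩ := this.prec (f := w) fun {s t} h ↦
    SModEq.sub_mem.2 (Submodule.smul_mono_left (S.J_le_pow s) (hJ h))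
  have hLJ (t : ℕ) : w t - L ∈ S.J t • (⊤ : Submodule R ω) := by
    obtain ⟨n, hn⟩ := S.cofinal t
    have h1 := hJ (le_max_left t n)
    have h2 := SModEq.sub_mem.1 (hL (max t n))
    have h3 := Submodule.smul_mono_left
      ((Ideal.pow_le_pow_right (le_max_right t n)).trans hn) h2
    rw [← sub_add_sub_cancel _ (w (max t n))]
    exact add_mem h1 h3
  refine ⟨L, S.hom_ext_cl fun t r ↦ ?_⟩
  rw [act_cl, map_smul, ← mul_one r, ← smul_eq_mul, map_smul, map_smul, hw, smul_eq_mul, mul_one]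
  congr 1
  rw [eq_comm, ← sub_eq_zero, ← map_sub, S.cl_eq_zero_of_mem (hLJ t)]

variable (S ω) in
/-- For a canonical module `ω` over a complete ring, every map between the top local cohomology
modules of `R` and `ω` is given by an element of `ω`. -/
def actEquiv (hω : S.IsCanonical ω) [Module.Finite R ω] [IsPrecomplete (maximalIdeal R) R] :
    ω ≃ₗ[R] (S.LCoh R S.d →ₗ[R] S.LCoh ω S.d) :=
  LinearEquiv.ofBijective (S.act ω) ⟨hω.act_injective, hω.act_surjective⟩

end act

end RegularParameters

end

section

open IsLocalRing Koszul ExtM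

namespace LC

variable {R : Type u} [CommRing R] {J : ℕ → Ideal R} (hJ : Antitone J) {A B C M M' M'' : Type u}
  [AddCommGroup A] [Module R A] [AddCommGroup B] [Module R B] [AddCommGroup C] [Module R C]
  [AddCommGroup M] [Module R M] [AddCommGroup M'] [Module R M'] [AddCommGroup M''] [Module R M'']

lemma map_comp (n : ℕ) (g : M →ₗ[R] M') (g' : M' →ₗ[R] M'') :
    map hJ n (g' ∘ₗ g) = map hJ n g' ∘ₗ map hJ n g :=
  hom_ext hJ fun t e ↦ by
    rw [LinearMap.comp_apply, map_of, map_of, map_of, post_post]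

lemma subsingleton (n : ℕ) (h : ∀ t, Subsingleton (ExtM R (R ⧸ J t) M n)) :
    Subsingleton (LC hJ M n) := by
  refine subsingleton_of_forall_eq 0 fun z ↦ ?_
  obtain ⟨t, e, rfl⟩ := exists_of hJ z
  have := h t
  rw [Subsingleton.elim e 0, map_zero]

variable (M') in
variable (M) in
/-- Functoriality of the direct limit, as a linear map. -/
def mapHom (n : ℕ) : (M →ₗ[R] M') →ₗ[R] LC hJ M n →ₗ[R] LC hJ M' n where
  toFun := map hJ n
  map_add' f g := hom_ext hJ fun t e ↦ by
    rw [LinearMap.add_apply, map_of, map_of, map_of, post_add, map_add]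
  map_smul' a f := hom_ext hJ fun t e ↦ by
    rw [LinearMap.smul_apply, map_of, map_of, post_smul, map_smul, RingHom.id_apply]

variable (E : SES R A B C)

/-- The connecting map of the long exact sequence of direct limits. -/
def δ (n : ℕ) : LC hJ C n →ₗ[R] LC hJ A (n + 1) :=
  lift hJ (fun t ↦ of hJ A (n + 1) t ∘ₗ E.δpost n) fun s t h e ↦ by
    rw [LinearMap.comp_apply, LinearMap.comp_apply, ← E.pre_δpost, of_pre hJ h]

lemma δ_of (n t : ℕ) (e : ExtM R (R ⧸ J t) C n) :
    δ hJ E n (of hJ C n t e) = of hJ A (n + 1) t (E.δpost n e) :=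
  lift_of hJ _ _ t e

lemma exact_map_δ (n : ℕ) : Function.Exact (map hJ n E.g) (δ hJ E n) := by
  intro z
  constructor
  · intro hz
    obtain ⟨t, e, rfl⟩ := exists_of hJ z
    rw [δ_of] at hz
    obtain ⟨s, hs, h⟩ := of_eq_zero hJ hz
    rw [E.pre_δpost] at h
    obtain ⟨e', he'⟩ := (E.exact_post₃ n _).1 h
    exact ⟨of hJ B n s e', by rw [map_of, he', of_pre hJ hs]⟩
  · rintro ⟨z, rfl⟩
    obtain ⟨t, e, rfl⟩ := exists_of hJ z
    rw [map_of, δ_of, (E.exact_post₃ n _).2 ⟨e, rfl⟩, map_zero]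

lemma exact_δ_map (n : ℕ) : Function.Exact (δ hJ E n) (map hJ (n + 1) E.f) := by
  intro z
  constructor
  · intro hz
    obtain ⟨t, e, rfl⟩ := exists_of hJ z
    rw [map_of] at hz
    obtain ⟨s, hs, h⟩ := of_eq_zero hJ hz
    rw [pre_post] at h
    obtain ⟨e', he'⟩ := (E.exact_post₁ n _).1 h
    exact ⟨of hJ C n s e', by rw [δ_of, he', of_pre hJ hs]⟩
  · rintro ⟨z, rfl⟩
    obtain ⟨t, e, rfl⟩ := exists_of hJ z
    rw [δ_of, map_of, (E.exact_post₁ n _).2 ⟨e, rfl⟩, map_zero]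

lemma δ_injective (n : ℕ) (h : Subsingleton (LC hJ B n)) : Function.Injective (δ hJ E n) := by
  rw [injective_iff_map_eq_zero]
  intro z hz
  obtain ⟨w, rfl⟩ := (exact_map_δ hJ E n z).1 hz
  rw [Subsingleton.elim w 0, map_zero]

lemma δ_bijective (n : ℕ) (h : Subsingleton (LC hJ B n)) (h' : Subsingleton (LC hJ B (n + 1))) :
    Function.Bijective (δ hJ E n) :=
  ⟨δ_injective hJ E n h, fun z ↦ (exact_δ_map hJ E n z).1 (Subsingleton.elim _ _)⟩

end LC

lemma ExtM.SES.δpre_surjective {R : Type u} [CommRing R] {A B C M : Type u} [AddCommGroup A]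
    [Module R A] [AddCommGroup B] [Module R B] [AddCommGroup C] [Module R C] [AddCommGroup M]
    [Module R M] [Module.Projective R B] (E : SES R A B C) (n : ℕ) :
    Function.Surjective (E.δpre (M := M) n) := by
  intro e
  have := ExtM.subsingleton_of_projective (R := R) (N := B) (M := M) n
  exact (E.exact_pre₃ n e).1 (Subsingleton.elim _ _)

lemma ExtM.SES.δpre_bijective {R : Type u} [CommRing R] {A B C M : Type u} [AddCommGroup A]
    [Module R A] [AddCommGroup B] [Module R B] [AddCommGroup C] [Module R C] [AddCommGroup M]
    [Module R M] [Module.Projective R B] (E : SES R A B C) (n : ℕ) :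
    Function.Bijective (E.δpre (M := M) (n + 1)) := by
  refine ⟨?_, E.δpre_surjective (n + 1)⟩
  rw [injective_iff_map_eq_zero]
  intro e he
  have := ExtM.subsingleton_of_projective (R := R) (N := B) (M := M) n
  obtain ⟨v, rfl⟩ := (E.exact_pre₁ (n + 1) e).1 he
  rw [Subsingleton.elim v 0, map_zero]

/-- Matlis-type duality in the first positive degree, deduced from degree zero. -/
lemma LC.nonempty_equiv_one {R : Type u} [CommRing R] {J : ℕ → Ideal R} (hJ : Antitone J)
    {A B C ω : Type u} [AddCommGroup A] [Module R A] [AddCommGroup B] [Module R B]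
    [AddCommGroup C] [Module R C] [AddCommGroup ω] [Module R ω] [Module.Projective R B]
    (E : SES R A B C) (n : ℕ) [Module.Injective R (LC hJ ω (n + 1))]
    (hA : Function.Bijective (LC.mapHom hJ A ω (n + 1)))
    (hB : Function.Surjective (LC.mapHom hJ B ω (n + 1))) (h : Subsingleton (LC hJ B n)) :
    Nonempty (ExtM R C ω 1 ≃ₗ[R] (LC hJ C n →ₗ[R] LC hJ ω (n + 1))) := by
  let p : (A →ₗ[R] ω) →ₗ[R] ExtM R C ω 1 := E.δpre 0 ∘ₗ (zeroEquiv R A ω).symm.toLinearMap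
  let q : (A →ₗ[R] ω) →ₗ[R] LC hJ C n →ₗ[R] LC hJ ω (n + 1) :=
    LinearMap.lcomp R _ (LC.δ hJ E n) ∘ₗ LC.mapHom hJ A ω (n + 1)
  have hq (f) : q f = LC.mapHom hJ A ω (n + 1) f ∘ₗ LC.δ hJ E n := rfl
  refine ⟨LinearEquiv.ofSurjectiveOfKer p q
    ((E.δpre_surjective 0).comp (zeroEquiv R A ω).symm.surjective) (fun φ ↦ ?_) ?_⟩
  · obtain ⟨ψ, hψ⟩ := Module.Injective.out (LC.δ hJ E n) (LC.δ_injective hJ E n h) φ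
    obtain ⟨f, rfl⟩ := hA.2 ψ
    exact ⟨f, LinearMap.ext hψ⟩
  · ext f
    rw [LinearMap.mem_ker, LinearMap.mem_ker, hq]
    trans ∃ f' : B →ₗ[R] ω, f' ∘ₗ E.f = f
    · refine (E.exact_pre₁ 0 _).trans ⟨?_, ?_⟩
      · rintro ⟨v, hv⟩
        obtain ⟨f', rfl⟩ := (zeroEquiv R B ω).symm.surjective v
        rw [pre_zeroEquiv_symm] at hv
        exact ⟨f', (zeroEquiv R A ω).symm.injective hv⟩
      · rintro ⟨f', rfl⟩
        exact ⟨_, pre_zeroEquiv_symm _ _⟩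
    · constructor
      · rintro ⟨f', rfl⟩
        have h1 : LC.map hJ (n + 1) E.f ∘ₗ LC.δ hJ E n = 0 :=
          (LC.exact_δ_map hJ E n).linearMap_comp_eq_zero
        change LC.map hJ (n + 1) _ ∘ₗ _ = 0
        rw [LC.map_comp, LinearMap.comp_assoc, h1, LinearMap.comp_zero]
      · intro hf
        let g := LC.map hJ (n + 1) E.f
        obtain ⟨φ, hφ⟩ := LinearMap.exists_comp_eq_of_ker_le g.surjective_rangeRestrict
          (g := LC.mapHom hJ A ω (n + 1) f) (by
            intro z hz
            rw [LinearMap.ker_rangeRestrict] at hz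
            obtain ⟨w, rfl⟩ := (LC.exact_δ_map hJ E n z).1 hz
            exact LinearMap.congr_fun hf w)
        obtain ⟨ψ, hψ⟩ := Module.Injective.out _ (LinearMap.range g).subtype_injective φ
        obtain ⟨f', rfl⟩ := hB ψ
        refine ⟨f', hA.1 ?_⟩
        rw [← hφ]
        change LC.map hJ (n + 1) _ = _
        rw [LC.map_comp]
        ext z
        exact hψ (g.rangeRestrict z)

namespace RegularParameters

variable {R : Type u} [CommRing R] [IsLocalRing R] {S : RegularParameters R}
  {ω : Type u} [AddCommGroup ω] [Module R ω]

lemma subsingleton_lcoh_finsupp (ι : Type u) (i : ℕ) (hi : i < S.d) :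
    Subsingleton (S.LCoh (ι →₀ R) i) :=
  LC.subsingleton S.antitone i fun t ↦ ext_subsingleton_of_lt _ S.d (S.reg t)
    (fun j hj ↦ (S.reg t j hj).finsupp ι) i hi

lemma IsCanonical.mapHom_bijective [IsNoetherianRing R] [IsPrecomplete (maximalIdeal R) R]
    [Module.Finite R ω] (hω : S.IsCanonical ω) (M : Type u) [AddCommGroup M] [Module R M] :
    Function.Bijective (LC.mapHom S.antitone M ω S.d) := by
  have key (f : M →ₗ[R] ω) :
      S.adj M (S.LCoh ω S.d) (LC.mapHom S.antitone M ω S.d f) = S.act ω ∘ₗ f := by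
    ext m h
    exact S.map_act f m h
  constructor
  · intro f f' h
    have h1 := key f
    rw [h, key f'] at h1
    exact (LinearMap.cancel_left hω.act_injective).1 h1.symm
  · intro φ
    refine ⟨(S.actEquiv ω hω).symm.toLinearMap ∘ₗ S.adj M _ φ, S.adj_injective ?_⟩
    rw [key, ← LinearMap.comp_assoc]
    ext m : 1
    exact (S.actEquiv ω hω).apply_symm_apply _

/-- Local duality. -/
theorem IsCanonical.duality [IsNoetherianRing R] [IsPrecomplete (maximalIdeal R) R]
    [Module.Finite R ω] (hω : S.IsCanonical ω) (j : ℕ) {i : ℕ} (h : i + j = S.d) (M : Type u)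
    [AddCommGroup M] [Module R M] :
    Nonempty (ExtM R M ω j ≃ₗ[R] (S.LCoh M i →ₗ[R] S.LCoh ω S.d)) := by
  have hinj := hω.injective
  induction j generalizing i M with
  | zero =>
    obtain rfl : i = S.d := h
    exact ⟨(zeroEquiv R M ω).trans (LinearEquiv.ofBijective _ (hω.mapHom_bijective M))⟩
  | succ j ih =>
    let E : SES R _ (M →₀ R) M := SES.ofSurjective (Finsupp.linearCombination R id)
      (Finsupp.linearCombination_id_surjective R M)
    have hi := S.subsingleton_lcoh_finsupp M i (by lia)
    rcases j with _ | j
    · have hA := hω.mapHom_bijective (LinearMap.ker (Finsupp.linearCombination R (id : M → M)))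
      have hB := hω.mapHom_bijective (M →₀ R)
      rw [zero_add] at h
      rw [← h] at hinj hA hB ⊢
      exact LC.nonempty_equiv_one S.antitone E i hA hB.2 hi
    · have hi' := S.subsingleton_lcoh_finsupp M (i + 1) (by lia)
      obtain ⟨e⟩ := ih (i := i + 1) (by lia)
        (LinearMap.ker (Finsupp.linearCombination R (id : M → M)))
      exact ⟨(LinearEquiv.ofBijective _ (E.δpre_bijective j)).symm ≪≫ₗ e ≪≫ₗ
        ((LinearEquiv.ofBijective _ (LC.δ_bijective S.antitone E i hi hi')).symm.congrLeft _ R)⟩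

end RegularParameters

end

/- `(R, 𝔪, 𝕜)` is a `d`-dimensional complete local Cohen-Macaulay ring (Cohen-Macaulayness
being expressed as `grade 𝔪 = d = dim R`) with canonical module `ω`, `I ⊆ R` is an ideal
with `c = grade I`, and `H^c_I(ω) ≠ 0`. -/
variable (R : Type) [CommRing R] [IsLocalRing R] [IsNoetherianRing R]
  [IsAdicComplete (IsLocalRing.maximalIdeal R) R]

/-- `Ext^c_R(H^c_I(ω_R), ω_R) ≅ Hom_R(H^{d-c}_𝔪(H^c_I(ω_R)), E)` as
`R`-modules, where `E` is an injective hull of the residue field `𝕜`: an injective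
`R`-module equipped with an injective map `ι : 𝕜 → E` whose image meets every nonzero
submodule of `E`. -/
theorem statement17 (d : ℕ) (hd : ringKrullDim R = (d : WithBot ℕ∞))
    (hCM : idealGrade (IsLocalRing.maximalIdeal R) = (d : ℕ∞))
    (ω : ModuleCat R) (hω : IsCanonicalModule R d ω)
    (I : Ideal R) (c : ℕ) (hc : idealGrade I = (c : ℕ∞))
    (hne : ¬ Subsingleton ((localCohomology I c).obj ω))
    (E : Type) [AddCommGroup E] [Module R E] [Module.Injective R E]
    (ι : IsLocalRing.ResidueField R →ₗ[R] E) (hι : Function.Injective ι)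
    (hess : ∀ N : Submodule R E, N ≠ ⊥ → N ⊓ LinearMap.range ι ≠ ⊥) :
    Nonempty
      ((((Ext R (ModuleCat R) c).obj (op ((localCohomology I c).obj ω))).obj ω) ≃ₗ[R]
        (((localCohomology (IsLocalRing.maximalIdeal R) (d - c)).obj
            ((localCohomology I c).obj ω)) →ₗ[R] E)) := by
  obtain ⟨x, hreg, hmem, hcof⟩ := exists_regular_parameters hd hCM
  let S : RegularParameters R := ⟨d, x, hreg, hmem, hcof⟩
  obtain ⟨hfin, hsub, ⟨top⟩⟩ := hω
  have hS : S.IsCanonical ω :=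
    { subsingleton := fun i hi ↦
        have := hsub i hi
        (ExtM.ofDerived (ModuleCat.of R (IsLocalRing.ResidueField R)) ω
          i).symm.injective.subsingleton
      top := ⟨(ExtM.ofDerived (ModuleCat.of R (IsLocalRing.ResidueField R)) ω d).symm ≪≫ₗ top⟩ }
  have hcd : c ≤ d := by
    have := idealGrade_le_maximalIdeal I
    rw [hc, hCM] at this
    exact_mod_cast this
  obtain ⟨e⟩ := hS.duality c (Nat.sub_add_cancel hcd) ((localCohomology I c).obj ω)
  have := hS.injective
  obtain ⟨ι', hι', hess'⟩ := hS.exists_hull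
  obtain ⟨eE⟩ := Module.Injective.nonempty_equiv_of_essential ι' ι hι' hι hess' hess
  let eM := LC.localCohomologyEquiv (IsLocalRing.maximalIdeal R) (d - c)
      ((localCohomology I c).obj ω) ≪≫ₗ
    LC.equivOfCofinal (LC.pow_antitone _) _ (d - c) S.antitone
      (fun t ↦ ⟨t, S.J_le_pow t⟩) S.cofinal
  exact ⟨ExtM.ofDerived _ ω c ≪≫ₗ e ≪≫ₗ LinearEquiv.arrowCongr eM.symm eE⟩
end
end
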